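/- arXiv:1710.00243 — 2 statements merged into one kernel-verified Lean document; each statement's English description precedes it below -/
import Mathlib

section
/- Let d ≥ 1 and let R be a d-smooth ℂ-algebra such that R^{ab} has Krull dimension ≥ 2 and Spec(R^{ab}) is connected. Then the center of R equals ℂ·1 + I_{d+1}R. -/
noncomputable section

open scoped BigOperators

namespace NCGeom

variable (R : Type) [Ring R] [Algebra ℂ R]

/-- `lieLCS R n` is the `(n+1)`-st term `R_{n+1}^{Lie}` of the lower central series of `R`
viewed as a Lie algebra under `[a,b] = a*b - b*a`; so `lieLCS R 0 = R` and
`lieLCS R n = [R, lieLCS R (n-1)]`. -/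
def lieLCS : ℕ → Submodule ℂ R
  | 0 => ⊤
  | n + 1 => Submodule.span ℂ {x : R | ∃ a ∈ lieLCS n, ∃ b : R, x = a * b - b * a}

/-- The set of products `r₀ · a₁ · r₁ · … · aₘ · rₘ` where `aₖ ∈ R_{iₖ}^{Lie}`, `iₖ ≥ 2` and
`i₁ + … + iₘ ≥ n`. -/
def commSet (n : ℕ) : Set R :=
  {x : R | ∃ (m : ℕ) (i : Fin m → ℕ) (r : Fin (m + 1) → R) (a : Fin m → R),
    (∀ k, 2 ≤ i k) ∧ (n ≤ ∑ k, i k) ∧ (∀ k, a k ∈ lieLCS R (i k - 1)) ∧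
    x = r 0 * (List.ofFn fun k : Fin m => a k * r k.succ).prod}

/-- The commutator filtration
`I_n R = Σ_{i₁,…,iₘ ≥ 2, i₁+…+iₘ ≥ n} R·R_{i₁}^{Lie}·R·…·R·R_{iₘ}^{Lie}·R`
(the two-sided ideal spanned by the corresponding products). -/
def commFiltration (n : ℕ) : TwoSidedIdeal R := TwoSidedIdeal.span (commSet R n)

/-- `R` is NC-nilpotent of degree `d` if `I_{d+2} R = 0`. -/
def IsNCNilpotentOfDegree (d : ℕ) : Prop := ∀ x ∈ commFiltration R (d + 2), x = 0

/-- `R` is NC-nilpotent if it is NC-nilpotent of some degree, i.e. belongs to `𝒩`. -/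
def IsNCNilpotent : Prop := ∃ d, IsNCNilpotentOfDegree R d

variable {R}

/-- A surjection `π : R → S` onto a commutative algebra exhibits `S` as the abelianization
`R^{ab} = R/I₂R` of `R` if its kernel is exactly `I₂R`. -/
def IsAbelianization {S : Type} [CommRing S] [Algebra ℂ S] (π : R →ₐ[ℂ] S) : Prop :=
  Function.Surjective π ∧ ∀ x : R, π x = 0 ↔ x ∈ commFiltration R 2

/-- A central extension `0 → I → Λ' → Λ → 0` in `𝒩`: a surjection whose kernel `I` is a
central ideal with `I² = 0`. -/
structure IsCentralExtension {Λ' Λ : Type} [Ring Λ'] [Algebra ℂ Λ'] [Ring Λ] [Algebra ℂ Λ]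
    (p : Λ' →ₐ[ℂ] Λ) : Prop where
  surjective : Function.Surjective p
  central : ∀ x : Λ', p x = 0 → ∀ y : Λ', x * y = y * x
  sq_zero : ∀ x y : Λ', p x = 0 → p y = 0 → x * y = 0

variable (R) in
/-- An NC-nilpotent algebra `A` of degree `d` is `d`-smooth if for every central extension
`B' → B` in `𝒩_d`, every homomorphism `A → B` lifts to `A → B'`. -/
def IsdSmooth (d : ℕ) : Prop :=
  IsNCNilpotentOfDegree R d ∧
  ∀ (Λ' Λ : Type) (_ : Ring Λ') (_ : Algebra ℂ Λ') (_ : Ring Λ) (_ : Algebra ℂ Λ),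
    IsNCNilpotentOfDegree Λ' d → IsNCNilpotentOfDegree Λ d →
    ∀ p : Λ' →ₐ[ℂ] Λ, IsCentralExtension p →
      ∀ f : R →ₐ[ℂ] Λ, ∃ g : R →ₐ[ℂ] Λ', p.comp g = f

variable (R) in
/-- `R` is NC-complete: complete and separated with respect to the commutator filtration. -/
def IsNCComplete : Prop :=
  (∀ x : R, (∀ n, x ∈ commFiltration R n) → x = 0) ∧
  (∀ x : ℕ → R, (∀ n, x (n + 1) - x n ∈ commFiltration R n) →
    ∃ y : R, ∀ n, y - x n ∈ commFiltration R n)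

variable (R) in
/-- `R` is NC-smooth: NC-complete, and homomorphisms from `R` to NC-nilpotent algebras lift
along all central extensions in `𝒩`. -/
def IsNCSmooth : Prop :=
  IsNCComplete R ∧
  ∀ (Λ' Λ : Type) (_ : Ring Λ') (_ : Algebra ℂ Λ') (_ : Ring Λ) (_ : Algebra ℂ Λ),
    IsNCNilpotent Λ' → IsNCNilpotent Λ →
    ∀ p : Λ' →ₐ[ℂ] Λ, IsCentralExtension p →
      ∀ f : R →ₐ[ℂ] Λ, ∃ g : R →ₐ[ℂ] Λ', p.comp g = f

/-- Two algebra homomorphisms `f, g : A → B` are conjugate (equal in the category `a𝒩`)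
if `g = u f u⁻¹` for a unit `u ∈ B`. -/
def Conjugate {A B : Type} [Ring A] [Algebra ℂ A] [Ring B] [Algebra ℂ B]
    (f g : A →ₐ[ℂ] B) : Prop :=
  ∃ u : Bˣ, ∀ a : A, g a = ↑u * f a * ↑u⁻¹

end NCGeom

namespace NCGeom

section Filtration

variable {R : Type} [Ring R] [Algebra ℂ R]

/-- `CommWord n x` says that `x` is a product `r₀ a₁ r₁ ⋯ aₘ rₘ` of commutator weight `n`. -/
inductive CommWord : ℕ → R → Prop
  | base (r : R) : CommWord 0 r
  | step (r a y : R) (i n : ℕ) : a ∈ lieLCS R (i + 1) → CommWord n y →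
      CommWord (n + i + 2) (r * a * y)

theorem commWord_of_ofFn (m : ℕ) : ∀ (i : Fin m → ℕ) (r : Fin (m + 1) → R) (a : Fin m → R),
    (∀ k, 2 ≤ i k) → (∀ k, a k ∈ lieLCS R (i k - 1)) →
    CommWord (∑ k, i k) (r 0 * (List.ofFn fun k : Fin m => a k * r k.succ).prod) := by
  induction m with
  | zero => intro i r a _ _; simpa using CommWord.base (r 0)
  | succ m ih =>
    intro i r a hi ha
    have h := ih (fun k => i k.succ) (fun k => r k.succ) (fun k => a k.succ)
      (fun k => hi _) (fun k => ha _)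
    have h0 : i 0 = (i 0 - 2) + 2 := by have := hi 0; omega
    have h1 : a 0 ∈ lieLCS R (i 0 - 2 + 1) := by
      have := ha 0
      rwa [show i 0 - 1 = i 0 - 2 + 1 by omega] at this
    have h2 := CommWord.step (r 0) (a 0) _ _ _ h1 h
    rw [Fin.sum_univ_succ, List.ofFn_succ, List.prod_cons]
    convert h2 using 1
    · omega
    · simp [mul_assoc]

theorem CommWord.mem_commSet {n : ℕ} {x : R} (h : CommWord n x) : x ∈ commSet R n := by
  induction h with
  | base r => exact ⟨0, Fin.elim0, fun _ => r, Fin.elim0, by simp, by simp, by simp, by simp⟩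
  | step r a y i n ha _ ih =>
    obtain ⟨m, i', r', a', h1, h2, h3, h4⟩ := ih
    refine ⟨m + 1, Fin.cons (i + 2) i', Fin.cons r r', Fin.cons a a', ?_, ?_, ?_, ?_⟩
    · intro k; refine Fin.cases ?_ (fun k => ?_) k
      · simp
      · simpa using h1 k
    · rw [Fin.sum_univ_succ]; simp; omega
    · intro k; refine Fin.cases ?_ (fun k => ?_) k
      · simpa using ha
      · simpa using h3 k
    · rw [List.ofFn_succ, List.prod_cons, h4]
      simp [mul_assoc]

theorem CommWord.mem {n : ℕ} {x : R} (h : CommWord n x) : x ∈ commFiltration R n :=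
  TwoSidedIdeal.subset_span h.mem_commSet

theorem CommWord.mul_left {n : ℕ} {x : R} (h : CommWord n x) (r : R) : CommWord n (r * x) := by
  cases h with
  | base s => exact CommWord.base _
  | step s a y i n ha hy => simpa [mul_assoc] using CommWord.step (r * s) a y i n ha hy

theorem CommWord.mul {n m : ℕ} {x y : R} (hx : CommWord n x) (hy : CommWord m y) :
    CommWord (n + m) (x * y) := by
  induction hx with
  | base r => simpa using hy.mul_left r
  | step r a z i n ha _ ih =>
    have := CommWord.step r a _ i _ ha ih
    convert this using 1
    · omega
    · simp [mul_assoc]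

theorem commFiltration_induction {n : ℕ} (F : AddSubgroup R)
    (h : ∀ m x, n ≤ m → CommWord m x → x ∈ F) {x : R} (hx : x ∈ commFiltration R n) : x ∈ F := by
  have hw : ∀ x ∈ commSet R n, ∃ m, n ≤ m ∧ CommWord m x := by
    rintro x ⟨m, i, r, a, h1, h2, h3, rfl⟩
    exact ⟨_, h2, commWord_of_ofFn m i r a h1 h3⟩
  have hs : ∀ m x, n ≤ m → CommWord m x → x ∈ commSet R n := by
    rintro m x hm hx
    obtain ⟨k, i, r, a, h1, h2, h3, h4⟩ := hx.mem_commSet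
    exact ⟨k, i, r, a, h1, hm.trans h2, h3, h4⟩
  rw [commFiltration, TwoSidedIdeal.mem_span_iff_mem_addSubgroup_closure_absorbing] at hx
  · refine (AddSubgroup.closure_le F).2 ?_ hx
    intro y hy
    obtain ⟨m, hm, hy⟩ := hw y hy
    exact h m y hm hy
  · intro y z hz
    obtain ⟨m, hm, hz⟩ := hw z hz
    exact hs m _ hm (hz.mul_left y)
  · intro y z hy
    obtain ⟨m, hm, hy⟩ := hw y hy
    exact hs m _ hm (by simpa using hy.mul (CommWord.base z))

theorem commFiltration_antitone {n m : ℕ} (h : n ≤ m) {x : R} (hx : x ∈ commFiltration R m) :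
    x ∈ commFiltration R n := by
  refine TwoSidedIdeal.span_mono ?_ hx
  rintro x ⟨k, i, r, a, h1, h2, h3, h4⟩
  exact ⟨k, i, r, a, h1, h.trans h2, h3, h4⟩

theorem mem_commFiltration_zero (x : R) : x ∈ commFiltration R 0 := (CommWord.base x).mem

/-- The commutator filtration as a sequence of additive subgroups. -/
def commSubgroup (R : Type) [Ring R] [Algebra ℂ R] (n : ℕ) : AddSubgroup R where
  carrier := {x | x ∈ commFiltration R n}
  zero_mem' := (commFiltration R n).zero_mem
  add_mem' := fun h h' => (commFiltration R n).add_mem h h'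
  neg_mem' := fun h => (commFiltration R n).neg_mem h

theorem commFiltration_mul {n m : ℕ} {x y : R} (hx : x ∈ commFiltration R n)
    (hy : y ∈ commFiltration R m) : x * y ∈ commFiltration R (n + m) := by
  refine commFiltration_induction
    ((commSubgroup R (n + m)).comap (AddMonoidHom.mulRight y)) ?_ hx
  intro n' x hn hx
  change x * y ∈ commFiltration R (n + m)
  refine commFiltration_induction
    ((commSubgroup R (n + m)).comap (AddMonoidHom.mulLeft x)) ?_ hy
  intro m' y hm hy
  exact commFiltration_antitone (by omega) (hx.mul hy).mem

theorem lieLCS_mem_commFiltration {i : ℕ} {a : R} (ha : a ∈ lieLCS R (i + 1)) :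
    a ∈ commFiltration R (i + 2) := by
  simpa using (CommWord.step 1 a 1 i 0 ha (CommWord.base 1)).mem

theorem commutator_mem_lieLCS {i : ℕ} {a : R} (ha : a ∈ lieLCS R i) (b : R) :
    a * b - b * a ∈ lieLCS R (i + 1) := Submodule.subset_span ⟨a, ha, b, rfl⟩

theorem commutator_mem_two (a b : R) : a * b - b * a ∈ commFiltration R 2 :=
  lieLCS_mem_commFiltration (commutator_mem_lieLCS (i := 0) (by simp [lieLCS]) b)

theorem commutator_mem_succ {n : ℕ} {x : R} (hx : x ∈ commFiltration R n) (b : R) :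
    x * b - b * x ∈ commFiltration R (n + 1) := by
  have key : ∀ m x, CommWord m x → x * b - b * x ∈ commFiltration R (m + 1) := by
    intro m x hx
    induction hx with
    | base r => exact commFiltration_antitone (by omega) (commutator_mem_two r b)
    | step r a y i n ha hy ih =>
      have e : r * a * y * b - b * (r * a * y) =
          (r * b - b * r) * a * y + r * (a * b - b * a) * y + r * a * (y * b - b * y) := by
        noncomm_ring
      rw [e]
      refine (commFiltration R _).add_mem ((commFiltration R _).add_mem ?_ ?_) ?_
      · exact commFiltration_antitone (by omega) (commFiltration_mul (commFiltration_mul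
          (commutator_mem_two r b) (lieLCS_mem_commFiltration ha)) hy.mem)
      · exact commFiltration_antitone (by omega) (commFiltration_mul (commFiltration_mul
          (mem_commFiltration_zero r)
          (lieLCS_mem_commFiltration (commutator_mem_lieLCS ha b))) hy.mem)
      · exact commFiltration_antitone (by omega) (commFiltration_mul (commFiltration_mul
          (mem_commFiltration_zero r) (lieLCS_mem_commFiltration ha)) ih)
  refine commFiltration_induction ((commSubgroup R (n + 1)).comap
    (AddMonoidHom.mulRight b - AddMonoidHom.mulLeft b)) ?_ hx
  intro m x hm hx
  exact commFiltration_antitone (by omega) (key m x hx)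

theorem commFiltration_smul {n : ℕ} (c : ℂ) {x : R} (hx : x ∈ commFiltration R n) :
    c • x ∈ commFiltration R n := by
  rw [Algebra.smul_def]; exact (commFiltration R n).mul_mem_left _ _ hx

/-- A multiplicative filtration which drops commutators as the commutator filtration does. -/
structure IsCommFiltered {Λ : Type} [Ring Λ] [Algebra ℂ Λ] (F : ℕ → Submodule ℂ Λ) : Prop where
  zero : F 0 = ⊤
  anti : ∀ {n m}, n ≤ m → F m ≤ F n
  mul : ∀ {n m x y}, x ∈ F n → y ∈ F m → x * y ∈ F (n + m)
  comm : ∀ {n x} (b : Λ), x ∈ F n → x * b - b * x ∈ F (n + 1)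
  comm_two : ∀ a b : Λ, a * b - b * a ∈ F 2

theorem IsCommFiltered.map_mem {Λ : Type} [Ring Λ] [Algebra ℂ Λ] {F : ℕ → Submodule ℂ Λ}
    (hF : IsCommFiltered F) (f : R →ₐ[ℂ] Λ) {n : ℕ} {x : R} (hx : x ∈ commFiltration R n) :
    f x ∈ F n := by
  have hl : ∀ i, ∀ a ∈ lieLCS R (i + 1), f a ∈ F (i + 2) := by
    intro i
    induction i with
    | zero =>
      intro a ha
      refine (Submodule.span_le (p := (F 2).comap f.toLinearMap)).2 ?_ ha
      rintro x ⟨a, _, b, rfl⟩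
      simpa using hF.comm_two (f a) (f b)
    | succ i ih =>
      intro a ha
      refine (Submodule.span_le (p := (F (i + 1 + 2)).comap f.toLinearMap)).2 ?_ ha
      rintro x ⟨a, ha, b, rfl⟩
      simpa using hF.comm (f b) (ih a ha)
  refine commFiltration_induction ((F n).comap f.toLinearMap).toAddSubgroup ?_ hx
  intro m x hm hx
  refine hF.anti hm ?_
  clear hm
  change f x ∈ F m
  induction hx with
  | base r => simp [hF.zero]
  | step r a y i n ha _ ih =>
    rw [map_mul, map_mul]
    have := hF.mul (hF.mul (show f r ∈ F 0 by simp [hF.zero]) (hl i a ha)) ih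
    exact hF.anti (by omega) this

theorem isCommFiltered_of_commRing (B : Type) [CommRing B] [Algebra ℂ B] :
    IsCommFiltered (Λ := B) (fun n => if n = 0 then ⊤ else ⊥) := by
  refine ⟨by simp, ?_, ?_, ?_, ?_⟩
  · intro n m h
    rcases Nat.eq_zero_or_pos n with rfl | hn
    · simp
    · simp [hn.ne', (hn.trans_le h).ne']
  · intro n m x y hx hy
    rcases Nat.eq_zero_or_pos n with rfl | hn
    · rcases Nat.eq_zero_or_pos m with rfl | hm
      · simp
      · simp_all [hm.ne']
    · simp_all [hn.ne']
  · intro n x b _; simp [mul_comm]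
  · intro a b; simp [mul_comm]

theorem isNCNilpotentOfDegree_of_commRing (B : Type) [CommRing B] [Algebra ℂ B] (d : ℕ) :
    IsNCNilpotentOfDegree B d := by
  intro x hx
  simpa using (isCommFiltered_of_commRing B).map_mem (AlgHom.id ℂ B) hx

end Filtration

section Commutative

variable {S : Type} [CommRing S] [Algebra ℂ S]

theorem eq_zero_or_one_of_isIdempotentElem {S : Type} [CommRing S]
    (hconn : ConnectedSpace (PrimeSpectrum S)) {e : S}
    (he : IsIdempotentElem e) : e = 0 ∨ e = 1 := by
  have h : IsClopen (PrimeSpectrum.basicOpen e : Set (PrimeSpectrum S)) :=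
    PrimeSpectrum.isClopen_iff.2 ⟨e, he, rfl⟩
  rcases isClopen_iff.1 h with h | h
  · left
    refine PrimeSpectrum.basicOpen_injOn_isIdempotentElem he IsIdempotentElem.zero ?_
    ext1; simp [h]
  · right
    refine PrimeSpectrum.basicOpen_injOn_isIdempotentElem he IsIdempotentElem.one ?_
    ext1; simp [h]

theorem formallySmooth_of_isdSmooth {R : Type} [Ring R] [Algebra ℂ R] {d : ℕ}
    (hsm : IsdSmooth R d) (π : R →ₐ[ℂ] S) (hπ : IsAbelianization π) :
    Algebra.FormallySmooth ℂ S := by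
  refine Algebra.FormallySmooth.of_comp_surjective ?_
  intro B _ _ I hI f
  obtain ⟨g, hg⟩ := hsm.2 B (B ⧸ I) _ _ _ _ (isNCNilpotentOfDegree_of_commRing B d)
    (isNCNilpotentOfDegree_of_commRing _ d) (Ideal.Quotient.mkₐ ℂ I)
    ⟨Ideal.Quotient.mkₐ_surjective _ _, fun x _ y => mul_comm x y, fun x y hx hy => by
      have hx' : x ∈ I := Ideal.Quotient.eq_zero_iff_mem.1 hx
      have hy' : y ∈ I := Ideal.Quotient.eq_zero_iff_mem.1 hy
      have : x * y ∈ I ^ 2 := by rw [pow_two]; exact Ideal.mul_mem_mul hx' hy'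
      simpa [hI] using this⟩ (f.comp π)
  have hker : ∀ x, π x = 0 → g x = 0 := by
    intro x hx
    simpa using (isCommFiltered_of_commRing B).map_mem g ((hπ.2 x).1 hx)
  obtain ⟨sec, hsec⟩ := hπ.1.hasRightInverse
  have hsec' : ∀ x, g (sec (π x)) = g x := fun x => by
    rw [← sub_eq_zero, ← map_sub]; apply hker; rw [map_sub, hsec, sub_self]
  have hall : ∀ y y' : R, π y = π y' → g y = g y' := fun y y' h => by
    rw [← hsec' y, h, hsec']
  refine ⟨AlgHom.ofLinearMap
    { toFun := fun s => g (sec s)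
      map_add' := fun x y => by rw [← map_add]; apply hall; simp [hsec _]
      map_smul' := fun c x => by rw [RingHom.id_apply, ← map_smul]; apply hall; simp [hsec _] }
    ?_ ?_, ?_⟩
  · change g (sec 1) = 1
    rw [← map_one g]; apply hall; simp [hsec _]
  · intro x y
    change g (sec (x * y)) = g (sec x) * g (sec y)
    rw [← map_mul]; apply hall; simp [hsec _]
  · ext s
    have := DFunLike.congr_fun hg (sec s)
    simpa [hsec _] using this

theorem exists_differential_frame [Algebra.FiniteType ℂ S] [Algebra.FormallySmooth ℂ S] :
    ∃ (ι : Type) (_ : Fintype ι) (s : ι → S) (D : ι → Derivation ℂ S S), ∀ b : S,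
      KaehlerDifferential.D ℂ S b = ∑ i, D i b • KaehlerDifferential.D ℂ S (s i) := by
  have hspan := KaehlerDifferential.span_range_derivation ℂ S
  have hfg : (Submodule.span S (Set.range (KaehlerDifferential.D ℂ S))).FG := by
    rw [hspan]; exact Module.Finite.fg_top
  obtain ⟨t, ht, hts⟩ := (Submodule.fg_span_iff_fg_span_finset_subset _).1 hfg
  rw [hspan] at hts
  choose s hs using fun i : t => ht i.2
  let f : (t → S) →ₗ[S] Ω[S⁄ℂ] := Fintype.linearCombination S (fun i : t => (i : Ω[S⁄ℂ]))
  have hf : Function.Surjective f := by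
    rw [← LinearMap.range_eq_top, Fintype.range_linearCombination]
    simpa using hts.symm
  obtain ⟨g, hg⟩ := Module.projective_lifting_property f LinearMap.id hf
  refine ⟨t, inferInstance, s,
    fun i => (LinearMap.proj i ∘ₗ g).compDer (KaehlerDifferential.D ℂ S), fun b => ?_⟩
  have := LinearMap.congr_fun hg (KaehlerDifferential.D ℂ S b)
  simp only [LinearMap.comp_apply, LinearMap.id_apply, f, Fintype.linearCombination_apply] at this
  conv_lhs => rw [← this]
  simp [hs]

variable {ι : Type} [Fintype ι] {s : ι → S} {D : ι → Derivation ℂ S S}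

/-- `s` and `D` form a frame: `db = ∑ Dᵢ(b) dsᵢ` in the module of Kähler differentials. -/
def IsFrame (s : ι → S) (D : ι → Derivation ℂ S S) : Prop := ∀ b : S,
  KaehlerDifferential.D ℂ S b = ∑ i, D i b • KaehlerDifferential.D ℂ S (s i)

theorem IsFrame.derivation_apply (hD : IsFrame s D) {M : Type*} [AddCommGroup M] [Module ℂ M]
    [Module S M] [IsScalarTower ℂ S M] (δ : Derivation ℂ S M) (b : S) :
    δ b = ∑ i, D i b • δ (s i) := by
  rw [← Derivation.liftKaehlerDifferential_comp_D δ b, hD b]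
  simp [Derivation.liftKaehlerDifferential_comp_D]

theorem exists_character [Algebra.FiniteType ℂ S] (m : Ideal S) (hm : m.IsMaximal) :
    ∃ χ : S →ₐ[ℂ] ℂ, ∀ a, χ a = 0 ↔ a ∈ m := by
  let _ : Field (S ⧸ m) := Ideal.Quotient.field m
  have : Module.Finite ℂ (S ⧸ m) := finite_of_finite_type_of_isJacobsonRing ℂ (S ⧸ m)
  have hb := IsAlgClosed.algebraMap_bijective_of_isIntegral (k := ℂ) (K := S ⧸ m)
  let e : ℂ ≃ₐ[ℂ] (S ⧸ m) := AlgEquiv.ofBijective (Algebra.ofId ℂ _) hb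
  refine ⟨(e.symm : (S ⧸ m) →ₐ[ℂ] ℂ).comp (Ideal.Quotient.mkₐ ℂ m), fun a => ?_⟩
  simp [Ideal.Quotient.eq_zero_iff_mem]

theorem IsFrame.sub_mem_sq (hD : IsFrame s D) {m : Ideal S} {χ : S →ₐ[ℂ] ℂ}
    (hχ : ∀ a, χ a = 0 ↔ a ∈ m) (b : S) :
    (b - algebraMap ℂ S (χ b)) - ∑ i, D i b * (s i - algebraMap ℂ S (χ (s i))) ∈ m ^ 2 := by
  have hmem : ∀ a, a - algebraMap ℂ S (χ a) ∈ m := fun a => by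
    rw [← hχ]; simp
  let δ : Derivation ℂ S (S ⧸ m ^ 2) := Derivation.mk'
    ((Ideal.Quotient.mkₐ ℂ (m ^ 2)).toLinearMap ∘ₗ
      (LinearMap.id - (Algebra.linearMap ℂ S) ∘ₗ χ.toLinearMap)) (by
      intro a b
      have h1 : (a - algebraMap ℂ S (χ a)) * (b - algebraMap ℂ S (χ b)) ∈ m ^ 2 := by
        rw [pow_two]; exact Ideal.mul_mem_mul (hmem a) (hmem b)
      simp only [LinearMap.comp_apply, LinearMap.sub_apply, LinearMap.id_apply,
        AlgHom.toLinearMap_apply, Algebra.linearMap_apply, Ideal.Quotient.mkₐ_eq_mk,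
        Algebra.smul_def, Ideal.Quotient.algebraMap_eq, ← map_mul, ← map_add]
      rw [Ideal.Quotient.eq, ← neg_mem_iff]
      convert h1 using 1
      simp only [map_mul]; ring)
  have h := hD.derivation_apply δ b
  have hδ : ∀ b, δ b = Ideal.Quotient.mk (m ^ 2) (b - algebraMap ℂ S (χ b)) := fun b => rfl
  simp only [hδ, Algebra.smul_def, Ideal.Quotient.algebraMap_eq, ← map_mul, ← map_sum] at h
  rwa [Ideal.Quotient.eq] at h

end Commutative

section Minors

variable {S : Type} [CommRing S] [Algebra ℂ S] {ι : Type} [Fintype ι] {s : ι → S}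
  {D : ι → Derivation ℂ S S}

/-- The set of all `2 × 2` minors of Jacobian matrices with respect to `D`. -/
def minorSet (D : ι → Derivation ℂ S S) : Set S :=
  {k | ∃ a b y y', k = D a y * D b y' - D b y * D a y'}

theorem IsFrame.span_minorSet_idem (hD : IsFrame s D) :
    IsIdempotentElem (Ideal.span (minorSet D)) := by
  refine le_antisymm Ideal.mul_le_left ?_
  rw [Ideal.span_le]
  rintro k ⟨a, b, y, y', rfl⟩
  let M : ι → ι → S := fun i j => D a (s i) * D b (s j) - D b (s i) * D a (s j)
  let N : ι → ι → S := fun i j => D i y * D j y' - D j y * D i y'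
  have h1 : D a y * D b y' - D b y * D a y' = ∑ i, ∑ j, D i y * D j y' * M i j := by
    rw [hD.derivation_apply (D a) y, hD.derivation_apply (D b) y', hD.derivation_apply (D b) y,
      hD.derivation_apply (D a) y', Finset.sum_mul_sum, Finset.sum_mul_sum,
      ← Finset.sum_sub_distrib]
    refine Finset.sum_congr rfl fun i _ => ?_
    rw [← Finset.sum_sub_distrib]
    refine Finset.sum_congr rfl fun j _ => ?_
    simp only [M, smul_eq_mul]; ring
  have h2 : D a y * D b y' - D b y * D a y' = -∑ i, ∑ j, D j y * D i y' * M i j := by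
    rw [h1, Finset.sum_comm, ← Finset.sum_neg_distrib]
    refine Finset.sum_congr rfl fun i _ => ?_
    rw [← Finset.sum_neg_distrib]
    refine Finset.sum_congr rfl fun j _ => ?_
    simp only [M]; ring
  have h3 : (2 : S) * (D a y * D b y' - D b y * D a y') = ∑ i, ∑ j, N i j * M i j := by
    rw [two_mul]; nth_rewrite 1 [h1]; rw [h2, ← sub_eq_add_neg, ← Finset.sum_sub_distrib]
    refine Finset.sum_congr rfl fun i _ => ?_
    rw [← Finset.sum_sub_distrib]
    refine Finset.sum_congr rfl fun j _ => ?_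
    simp only [N]; ring
  have h4 : D a y * D b y' - D b y * D a y' =
      algebraMap ℂ S (1 / 2) * ((2 : S) * (D a y * D b y' - D b y * D a y')) := by
    rw [← mul_assoc, ← map_ofNat (algebraMap ℂ S) 2, ← map_mul]; simp
  rw [SetLike.mem_coe, h4, h3]
  refine Ideal.mul_mem_left _ _ (sum_mem fun i _ => sum_mem fun j _ => Ideal.mul_mem_mul ?_ ?_)
  · exact Ideal.subset_span ⟨i, j, y, y', rfl⟩
  · exact Ideal.subset_span ⟨a, b, s i, s j, rfl⟩

theorem IsFrame.exists_le_span_sup_sq [Algebra.FiniteType ℂ S] (hD : IsFrame s D)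
    (hW : ∀ k ∈ minorSet D, k = 0) {m : Ideal S} (hm : m.IsMaximal) :
    ∃ a ∈ m, m ≤ Ideal.span {a} ⊔ m ^ 2 := by
  obtain ⟨χ, hχ⟩ := exists_character m hm
  have hsq : ∀ b ∈ m, b - ∑ i, D i b * (s i - algebraMap ℂ S (χ (s i))) ∈ m ^ 2 := by
    intro b hb
    have := hD.sub_mem_sq hχ b
    rwa [(hχ b).2 hb, map_zero, sub_zero] at this
  by_cases hc : ∃ i, ∃ a ∈ m, D i a ∉ m
  · obtain ⟨i, a, ha, hi⟩ := hc
    refine ⟨a, ha, fun b hb => ?_⟩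
    have h1 : D i a * b - D i b * a ∈ m ^ 2 := by
      have e : D i a * b - D i b * a =
          D i a * (b - ∑ j, D j b * (s j - algebraMap ℂ S (χ (s j)))) -
          D i b * (a - ∑ j, D j a * (s j - algebraMap ℂ S (χ (s j)))) := by
        have : D i a * ∑ j, D j b * (s j - algebraMap ℂ S (χ (s j))) =
            D i b * ∑ j, D j a * (s j - algebraMap ℂ S (χ (s j))) := by
          rw [Finset.mul_sum, Finset.mul_sum]
          refine Finset.sum_congr rfl fun j _ => ?_
          have := hW _ ⟨i, j, a, b, rfl⟩
          linear_combination (s j - algebraMap ℂ S (χ (s j))) * this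
        linear_combination this
      rw [e]
      exact sub_mem (Ideal.mul_mem_left _ _ (hsq b hb)) (Ideal.mul_mem_left _ _ (hsq a ha))
    obtain ⟨u, hu⟩ := hm.exists_inv hi
    obtain ⟨v, hv, huv⟩ := hu
    have e : b = u * D i b * a + (u * (D i a * b - D i b * a) + v * b) := by
      linear_combination (-b) * huv
    rw [e]
    refine Submodule.add_mem_sup (Ideal.mul_mem_left _ _ (Ideal.mem_span_singleton_self a))
      (add_mem (Ideal.mul_mem_left _ _ h1) ?_)
    rw [pow_two]; exact Ideal.mul_mem_mul hv hb
  · push Not at hc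
    refine ⟨0, zero_mem _, fun b hb => Submodule.mem_sup_right ?_⟩
    have h1 : ∑ i, D i b * (s i - algebraMap ℂ S (χ (s i))) ∈ m ^ 2 := sum_mem fun i _ => by
      rw [pow_two]
      exact Ideal.mul_mem_mul (hc i b hb) ((hχ _).1 (by simp))
    have := add_mem (hsq b hb) h1
    simpa using this

theorem height_le_one_of_le_span_sup_sq {S : Type} [CommRing S] [IsNoetherianRing S]
    {m : Ideal S} (hm : m.IsMaximal) {a : S} (ha : a ∈ m) (h : m ≤ Ideal.span {a} ⊔ m ^ 2) : m.height ≤ 1 := by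
  have := hm.isPrime
  obtain ⟨p, hp, hpm⟩ := Ideal.exists_minimalPrimes_le
    (I := Ideal.span {a}) (J := m) (by simpa [Ideal.span_le] using ha)
  have hap : Ideal.span {a} ≤ p := hp.1.2
  have hprime : p.IsPrime := hp.1.1
  have hpm' : p = m := by
    refine le_antisymm hpm ?_
    obtain ⟨r, hr, hrm⟩ := Submodule.exists_sub_one_mem_and_smul_le_of_fg_of_le_sup
      (I := m) (N := p) (N' := m) (P := m) (IsNoetherian.noetherian m) le_rfl
      (h.trans (sup_le_sup hap (by rw [pow_two, smul_eq_mul])))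
    intro b hb
    have h1 : r * b ∈ p := hrm (Submodule.smul_mem_pointwise_smul b r m hb)
    refine (hprime.mem_or_mem h1).resolve_left fun hrp => ?_
    refine hm.ne_top ((Ideal.eq_top_iff_one _).2 ?_)
    have := sub_mem (hpm hrp) hr
    simpa using this
  exact Ideal.height_le_one_of_isPrincipal_of_mem_minimalPrimes (Ideal.span {a}) m (hpm' ▸ hp)

theorem IsFrame.span_minorSet_eq_top [Algebra.FiniteType ℂ S] (hD : IsFrame s D)
    (hdim : 2 ≤ ringKrullDim S) (hconn : ConnectedSpace (PrimeSpectrum S)) :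
    Ideal.span (minorSet D) = ⊤ := by
  have : IsNoetherianRing S := Algebra.FiniteType.isNoetherianRing ℂ S
  obtain ⟨e, he, hW⟩ := (Ideal.isIdempotentElem_iff_of_fg _
    (IsNoetherian.noetherian _)).1 hD.span_minorSet_idem
  rcases eq_zero_or_one_of_isIdempotentElem hconn he with rfl | rfl
  · exfalso
    have hz : ∀ k ∈ minorSet D, k = 0 := fun k hk => by
      have : k ∈ Ideal.span (minorSet D) := Ideal.subset_span hk
      rw [hW] at this
      simpa using this
    have h1 : ringKrullDim S ≤ (1 : ℕ∞) := by
      rw [ringKrullDim_le_iff_isMaximal_height_le]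
      intro m hm
      obtain ⟨a, ha, h⟩ := hD.exists_le_span_sup_sq hz hm
      exact WithBot.coe_le_coe.2 (height_le_one_of_le_span_sup_sq hm ha h)
    have h2 : ((2 : ℕ∞) : WithBot ℕ∞) ≤ (1 : ℕ∞) := hdim.trans h1
    exact absurd (WithBot.coe_le_coe.1 h2) (by decide)
  · rw [hW]; exact Ideal.span_singleton_one

theorem eq_zero_of_minorSet_sq_mul {ι : Type} {D : ι → Derivation ℂ S S}
    (hW : Ideal.span (minorSet D) = ⊤) {u : S}
    (hu : ∀ k ∈ minorSet D, k ^ 2 * u = 0) : u = 0 := by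
  have h1 := Ideal.span_pow_eq_top _ hW 2
  have h2 : Ideal.span (Set.image (fun x => x ^ 2) (minorSet D)) ≤
      LinearMap.ker (LinearMap.mulRight S u) := by
    rw [Ideal.span_le]
    rintro _ ⟨k, hk, rfl⟩
    simpa using hu k hk
  have h3 : (1 : S) ∈ LinearMap.ker (LinearMap.mulRight S u) := h2 (h1 ▸ Submodule.mem_top)
  simpa using h3

theorem IsFrame.mem_pow_of_apply_eq_zero [Algebra.FiniteType ℂ S] (hD : IsFrame s D)
    {m : Ideal S} (hm : m.IsMaximal) {z : S} (hz : z ∈ m) (hDz : ∀ i, D i z = 0) (n : ℕ) :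
    z ∈ m ^ n := by
  obtain ⟨χ, hχ⟩ := exists_character m hm
  let E : Derivation ℂ S S := ∑ i, (s i - algebraMap ℂ S (χ (s i))) • D i
  have hE : ∀ b, E b = ∑ i, D i b * (s i - algebraMap ℂ S (χ (s i))) := fun b => by
    have h : ∀ t : Finset ι, (∑ i ∈ t, (s i - algebraMap ℂ S (χ (s i))) • D i) b =
        ∑ i ∈ t, D i b * (s i - algebraMap ℂ S (χ (s i))) := by
      classical
      intro t
      induction t using Finset.induction_on with
      | empty => simp
      | insert i t hi ih =>
        rw [Finset.sum_insert hi, Finset.sum_insert hi, Derivation.add_apply, ih]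
        simp [mul_comm]
    exact h Finset.univ
  have hE1 : ∀ b, E b ∈ m := fun b => by
    rw [hE]
    exact sum_mem fun i _ => Ideal.mul_mem_left _ _ ((hχ _).1 (by simp))
  have hE2 : ∀ b ∈ m, E b - b ∈ m ^ 2 := fun b hb => by
    have := hD.sub_mem_sq hχ b
    rw [(hχ b).2 hb, map_zero, sub_zero, ← hE] at this
    rw [← neg_mem_iff]; simpa using this
  have key : ∀ n : ℕ, ∀ b ∈ m ^ n, E b - n * b ∈ m ^ (n + 1) := by
    intro n
    induction n with
    | zero => intro b _; simpa using hE1 b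
    | succ n ih =>
      intro b hb
      rw [pow_succ] at hb
      refine Submodule.mul_induction_on hb ?_ ?_
      · intro a ha c hc
        have e : E (a * c) - ((n + 1 : ℕ) : S) * (a * c) =
            (E a - n * a) * c + a * (E c - c) := by
          rw [Derivation.leibniz]; simp only [smul_eq_mul]; push_cast; ring
        rw [e]
        refine add_mem ?_ ?_
        · rw [pow_succ m (n + 1)]; exact Ideal.mul_mem_mul (ih a ha) hc
        · rw [show n + 1 + 1 = n + 2 by omega, pow_add]
          exact Ideal.mul_mem_mul ha (hE2 c hc)
      · intro a c ha hc
        have e : E (a + c) - ((n + 1 : ℕ) : S) * (a + c) =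
            (E a - ((n + 1 : ℕ) : S) * a) + (E c - ((n + 1 : ℕ) : S) * c) := by
          rw [map_add]; ring
        rw [e]; exact add_mem ha hc
  have hEz : E z = 0 := by rw [hE]; simp [hDz]
  induction n with
  | zero => simp
  | succ n ih =>
    rcases Nat.eq_zero_or_pos n with rfl | hn
    · simpa using hz
    · have h := key n z ih
      rw [hEz, zero_sub, neg_mem_iff] at h
      have e : z = algebraMap ℂ S (1 / n) * (n * z) := by
        rw [← mul_assoc, show (n : S) = algebraMap ℂ S n by simp, ← map_mul]
        have : (n : ℂ) ≠ 0 := by exact_mod_cast hn.ne'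
        rw [one_div_mul_cancel this]; simp
      rw [e]; exact Ideal.mul_mem_left _ _ h

theorem IsFrame.exists_eq_algebraMap [Algebra.FiniteType ℂ S] (hD : IsFrame s D)
    (hconn : ConnectedSpace (PrimeSpectrum S)) {x : S} (hx : ∀ i, D i x = 0) :
    ∃ c : ℂ, x = algebraMap ℂ S c := by
  have : IsNoetherianRing S := Algebra.FiniteType.isNoetherianRing ℂ S
  obtain ⟨p⟩ := hconn.toNonempty
  obtain ⟨m, hm, -⟩ := Ideal.exists_le_maximal p.asIdeal p.isPrime.ne_top
  obtain ⟨χ, hχ⟩ := exists_character m hm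
  refine ⟨χ x, ?_⟩
  rw [← sub_eq_zero]
  have hzm : x - algebraMap ℂ S (χ x) ∈ m := (hχ _).1 (by simp)
  have hDz : ∀ i, D i (x - algebraMap ℂ S (χ x)) = 0 := fun i => by simp [hx]
  generalize x - algebraMap ℂ S (χ x) = z at hzm hDz
  let J : Ideal S := LinearMap.ker (LinearMap.mulRight S z)
  have hJ : J ⊔ Ideal.span {z} = ⊤ := by
    by_contra hne
    obtain ⟨m', hm', hle⟩ := Ideal.exists_le_maximal _ hne
    have hz : z ∈ m' := hle (Submodule.mem_sup_right (Ideal.mem_span_singleton_self z))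
    have h1 : z ∈ (⨅ i : ℕ, m' ^ i • ⊤ : Submodule S S) := by
      rw [Submodule.mem_iInf]
      intro i
      simpa using hD.mem_pow_of_apply_eq_zero hm' hz hDz i
    obtain ⟨r, hr⟩ := (Ideal.mem_iInf_smul_pow_eq_bot_iff m' z).1 h1
    have h2 : (1 - (r : S)) ∈ J := by
      simp only [J, LinearMap.mem_ker, LinearMap.mulRight_apply]
      rw [smul_eq_mul] at hr
      linear_combination -hr
    have h3 := add_mem (hle (Submodule.mem_sup_left h2)) r.2
    exact hm'.ne_top ((Ideal.eq_top_iff_one _).2 (by simpa using h3))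
  obtain ⟨a, ha, w, hw, haw⟩ := Submodule.mem_sup.1 (hJ ▸ Submodule.mem_top : (1 : S) ∈ _)
  obtain ⟨b, rfl⟩ := Ideal.mem_span_singleton'.1 hw
  have ha' : a * z = 0 := by simpa [J] using ha
  have hz2 : z = b * z * z := by linear_combination (-z) * haw + ha'
  have hid : IsIdempotentElem (b * z) := by
    change b * z * (b * z) = b * z
    linear_combination (-b) * hz2
  rcases eq_zero_or_one_of_isIdempotentElem hconn hid with h | h
  · rw [hz2, h, zero_mul]
  · exact absurd ((Ideal.eq_top_iff_one _).2 (h ▸ Ideal.mul_mem_left _ b hzm)) hm.ne_top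

end Minors

section Words

open MonoidAlgebra

/-- The free algebra on `ι` with coefficients in `S`. -/
abbrev WordAlg (S ι : Type) [CommRing S] : Type := MonoidAlgebra S (FreeMonoid ι)

variable {S : Type} [CommRing S] {ι : Type}

theorem coeff_mul_eq_zero {n m : ℕ} {f g : WordAlg S ι} (hf : ∀ w, w.length < n → f.coeff w = 0)
    (hg : ∀ w, w.length < m → g.coeff w = 0) (w : FreeMonoid ι) (hw : w.length < n + m) :
    (f * g).coeff w = 0 := by
  classical
  rw [coeff_mul]
  refine Finset.sum_eq_zero fun a _ => Finset.sum_eq_zero fun b _ => ?_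
  dsimp only
  split_ifs with h
  · rw [← h, FreeMonoid.length_mul] at hw
    rcases lt_or_ge a.length n with h1 | h1
    · rw [hf a h1, zero_mul]
    · rw [hg b (by omega), mul_zero]
  · rfl

/-- The ideal of elements supported on words of length at least `n`. -/
def theta (S ι : Type) [CommRing S] (n : ℕ) : Ideal (WordAlg S ι) where
  carrier := {f | ∀ w, w.length < n → f.coeff w = 0}
  zero_mem' := by intro w _; simp
  add_mem' := by intro f g hf hg w hw; simp [hf w hw, hg w hw]
  smul_mem' := by
    intro c f hf w hw
    exact coeff_mul_eq_zero (n := 0) (m := n) (by simp) hf w (by simpa using hw)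

theorem mem_theta {n : ℕ} {f : WordAlg S ι} :
    f ∈ theta S ι n ↔ ∀ w, w.length < n → f.coeff w = 0 := Iff.rfl

theorem theta_mul {n m : ℕ} {f g : WordAlg S ι} (hf : f ∈ theta S ι n) (hg : g ∈ theta S ι m) :
    f * g ∈ theta S ι (n + m) := coeff_mul_eq_zero hf hg

instance (n : ℕ) : (theta S ι n).IsTwoSided :=
  ⟨fun b h => theta_mul (m := 0) h (by simp [mem_theta])⟩

theorem theta_anti {n m : ℕ} (h : n ≤ m) : theta S ι m ≤ theta S ι n :=
  fun _ hf w hw => hf w (hw.trans_le h)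

theorem mem_theta_zero (f : WordAlg S ι) : f ∈ theta S ι 0 := by simp [mem_theta]

theorem single_mem_theta {n : ℕ} {w : FreeMonoid ι} (hw : n ≤ w.length) (a : S) :
    single w a ∈ theta S ι n := by
  classical
  intro w' hw'
  rw [coeff_single, Finsupp.single_apply, if_neg]
  rintro rfl; omega

theorem theta_induction {n : ℕ} {P : WordAlg S ι → Prop} (h0 : P 0)
    (hadd : ∀ f g, P f → P g → P (f + g)) (hs : ∀ w a, n ≤ w.length → P (single w a))
    {f : WordAlg S ι} (hf : f ∈ theta S ι n) : P f := by
  rw [← sum_coeff_single f]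
  refine Finset.sum_induction _ P hadd h0 fun w hw => ?_
  rcases lt_or_ge w.length n with h | h
  · rw [hf w h]; simpa using h0
  · exact hs w _ h

theorem commutator_mem_of_single {n k : ℕ}
    (h : ∀ w a w' a', n ≤ w.length → (single w a * single w' a' - single w' a' * single w a :
      WordAlg S ι) ∈ theta S ι k) {f : WordAlg S ι} (hf : f ∈ theta S ι n) (g : WordAlg S ι) :
    f * g - g * f ∈ theta S ι k := by
  refine theta_induction (P := fun f => f * g - g * f ∈ theta S ι k) (by simp) ?_ ?_ hf
  · intro f f' h h'
    have e : (f + f') * g - g * (f + f') = (f * g - g * f) + (f' * g - g * f') := by noncomm_ring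
    rw [e]; exact add_mem h h'
  · intro w a hw
    refine theta_induction (n := 0)
      (P := fun g => single w a * g - g * single w a ∈ theta S ι k) (by simp) ?_ ?_
      (mem_theta_zero g)
    · intro f f' h h'
      have e : single w a * (f + f') - (f + f') * single w a =
        (single w a * f - f * single w a) + (single w a * f' - f' * single w a) := by noncomm_ring
      rw [e]; exact add_mem h h'
    · intro w' a' _
      exact h w a w' a' hw

theorem single_commutator_mem (w w' : FreeMonoid ι) (a a' : S) {k : ℕ}
    (hk : w ≠ 1 → w' ≠ 1 → k ≤ w.length + w'.length) :
    (single w a * single w' a' - single w' a' * single w a : WordAlg S ι) ∈ theta S ι k := by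
  rw [single_mul_single, single_mul_single]
  by_cases h : w = 1
  · subst h; simp [mul_comm]
  by_cases h' : w' = 1
  · subst h'; simp [mul_comm]
  have := hk h h'
  exact sub_mem (single_mem_theta (by rw [FreeMonoid.length_mul]; omega) _)
    (single_mem_theta (by rw [FreeMonoid.length_mul]; omega) _)

theorem one_le_length {w : FreeMonoid ι} (h : w ≠ 1) : 1 ≤ w.length := by
  rw [Nat.one_le_iff_ne_zero]; rwa [Ne, FreeMonoid.length_eq_zero]

theorem theta_commutator {n : ℕ} {f : WordAlg S ι} (hf : f ∈ theta S ι n) (g : WordAlg S ι) :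
    f * g - g * f ∈ theta S ι (n + 1) :=
  commutator_mem_of_single (fun w a w' a' hw => single_commutator_mem w w' a a' fun _ h' => by
    have := one_le_length h'; omega) hf g

theorem theta_commutator_two (f g : WordAlg S ι) : f * g - g * f ∈ theta S ι 2 :=
  commutator_mem_of_single (n := 0)
    (fun w a w' a' _ => single_commutator_mem w w' a a' fun h h' => by
      have := one_le_length h; have := one_le_length h'; omega) (mem_theta_zero f) g

variable [Algebra ℂ S]

/-- The truncation of the free algebra at words of length `k`. -/
abbrev Trunc (S ι : Type) [CommRing S] [Algebra ℂ S] (k : ℕ) : Type := WordAlg S ι ⧸ theta S ι k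

/-- The projection onto the truncation. -/
abbrev Trunc.mk (S ι : Type) [CommRing S] [Algebra ℂ S] (k : ℕ) : WordAlg S ι →ₐ[ℂ] Trunc S ι k :=
  Ideal.Quotient.mkₐ ℂ (theta S ι k)

theorem Trunc.mk_surjective (k : ℕ) : Function.Surjective (Trunc.mk S ι k) :=
  Ideal.Quotient.mkₐ_surjective _ _

theorem Trunc.mk_eq_zero {k : ℕ} {f : WordAlg S ι} : Trunc.mk S ι k f = 0 ↔ f ∈ theta S ι k :=
  Ideal.Quotient.eq_zero_iff_mem

/-- The filtration of the truncation by word length. -/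
def Trunc.filt (S ι : Type) [CommRing S] [Algebra ℂ S] (k n : ℕ) : Submodule ℂ (Trunc S ι k) :=
  ((theta S ι n).restrictScalars ℂ).map (Trunc.mk S ι k).toLinearMap

theorem Trunc.mem_filt {k n : ℕ} {y : Trunc S ι k} :
    y ∈ Trunc.filt S ι k n ↔ ∃ f ∈ theta S ι n, Trunc.mk S ι k f = y := Iff.rfl

theorem Trunc.mk_mem_filt {k n : ℕ} {f : WordAlg S ι} (h : f ∈ theta S ι n) :
    Trunc.mk S ι k f ∈ Trunc.filt S ι k n := ⟨f, h, rfl⟩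

theorem Trunc.mem_theta_of_mk_mem_filt {k n : ℕ} (hn : n ≤ k) {f : WordAlg S ι}
    (h : Trunc.mk S ι k f ∈ Trunc.filt S ι k n) : f ∈ theta S ι n := by
  obtain ⟨g, hg, hgf⟩ := Trunc.mem_filt.1 h
  have h1 : f - g ∈ theta S ι k := by
    rw [← Trunc.mk_eq_zero, map_sub, hgf, sub_self]
  simpa using add_mem (theta_anti hn h1) hg

theorem Trunc.isCommFiltered (k : ℕ) : IsCommFiltered (Trunc.filt S ι k) := by
  refine ⟨?_, ?_, ?_, ?_, ?_⟩
  · rw [eq_top_iff]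
    intro y _
    obtain ⟨f, rfl⟩ := Trunc.mk_surjective k y
    exact Trunc.mk_mem_filt (mem_theta_zero f)
  · rintro n m h _ ⟨f, hf, rfl⟩
    exact Trunc.mk_mem_filt (theta_anti h hf)
  · rintro n m _ _ ⟨f, hf, rfl⟩ ⟨g, hg, rfl⟩
    exact ⟨f * g, theta_mul hf hg, map_mul (Trunc.mk S ι k) f g⟩
  · rintro n _ b ⟨f, hf, rfl⟩
    obtain ⟨g, rfl⟩ := Trunc.mk_surjective k b
    exact ⟨f * g - g * f, theta_commutator hf g, by simp⟩
  · intro a b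
    obtain ⟨f, rfl⟩ := Trunc.mk_surjective k a
    obtain ⟨g, rfl⟩ := Trunc.mk_surjective k b
    exact ⟨f * g - g * f, theta_commutator_two f g, by simp⟩

theorem Trunc.isNCNilpotentOfDegree {k d : ℕ} (h : k ≤ d + 2) :
    IsNCNilpotentOfDegree (Trunc S ι k) d := by
  intro x hx
  obtain ⟨f, hf, hfx⟩ := (Trunc.isCommFiltered k).map_mem (AlgHom.id ℂ _) hx
  have : x = Trunc.mk S ι k f := hfx.symm
  rw [this, Trunc.mk_eq_zero]
  exact theta_anti h hf

/-- The projection between successive truncations. -/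
def Trunc.proj (S ι : Type) [CommRing S] [Algebra ℂ S] (k : ℕ) :
    Trunc S ι (k + 1) →ₐ[ℂ] Trunc S ι k :=
  Ideal.Quotient.factorₐ ℂ (theta_anti (Nat.le_succ k))

theorem Trunc.proj_mk (k : ℕ) (f : WordAlg S ι) :
    Trunc.proj S ι k (Trunc.mk S ι (k + 1) f) = Trunc.mk S ι k f := rfl

theorem Trunc.isCentralExtension_proj {k : ℕ} (hk : 1 ≤ k) :
    IsCentralExtension (Trunc.proj S ι k) := by
  refine ⟨?_, ?_, ?_⟩
  · intro y
    obtain ⟨f, rfl⟩ := Trunc.mk_surjective k y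
    exact ⟨Trunc.mk S ι (k + 1) f, rfl⟩
  · intro x hx y
    obtain ⟨f, rfl⟩ := Trunc.mk_surjective _ x
    obtain ⟨g, rfl⟩ := Trunc.mk_surjective _ y
    rw [Trunc.proj_mk, Trunc.mk_eq_zero] at hx
    rw [← sub_eq_zero, ← map_mul, ← map_mul, ← map_sub, Trunc.mk_eq_zero]
    exact theta_commutator hx g
  · intro x y hx hy
    obtain ⟨f, rfl⟩ := Trunc.mk_surjective _ x
    obtain ⟨g, rfl⟩ := Trunc.mk_surjective _ y
    rw [Trunc.proj_mk, Trunc.mk_eq_zero] at hx hy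
    rw [← map_mul, Trunc.mk_eq_zero]
    exact theta_anti (by omega) (theta_mul hx hy)

variable [Fintype ι]

/-- The linear form `∑ Dᵢ(b) θᵢ` in the free algebra. -/
def diffWord (D : ι → Derivation ℂ S S) : S →ₗ[ℂ] WordAlg S ι where
  toFun b := ∑ i, single (FreeMonoid.of i) (D i b)
  map_add' a b := by simp [single_add, Finset.sum_add_distrib]
  map_smul' c b := by simp [← smul_single, Finset.smul_sum]

variable (D : ι → Derivation ℂ S S)

theorem diffWord_apply (b : S) :
    diffWord D b = ∑ i, single (FreeMonoid.of i) (D i b) := rfl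

theorem diffWord_mem_theta (b : S) : diffWord D b ∈ theta S ι 1 :=
  sum_mem fun i _ => single_mem_theta (by simp) _

theorem diffWord_mul (a b : S) :
    diffWord D (a * b) = single 1 a * diffWord D b + diffWord D a * single 1 b := by
  simp only [diffWord_apply, Finset.mul_sum, Finset.sum_mul, single_mul_single, one_mul, mul_one,
    ← Finset.sum_add_distrib, ← single_add, Derivation.leibniz, smul_eq_mul, mul_comm b]

/-- The first-order Taylor map `b ↦ b + ∑ Dᵢ(b) θᵢ` modulo words of length two. -/
def taylorTwo : S →ₐ[ℂ] Trunc S ι 2 :=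
  AlgHom.ofLinearMap ((Trunc.mk S ι 2).toLinearMap ∘ₗ
    ((singleOneAlgHom (R := ℂ) (A := S) (M := FreeMonoid ι)).toLinearMap + diffWord D))
  (by
    change Trunc.mk S ι 2 (single 1 1 + diffWord D 1) = 1
    rw [show diffWord D (1 : S) = 0 by simp [diffWord_apply], add_zero, ← one_def, map_one])
  (by
    intro a b
    change Trunc.mk S ι 2 (single 1 (a * b) + diffWord D (a * b)) =
      Trunc.mk S ι 2 (single 1 a + diffWord D a) * Trunc.mk S ι 2 (single 1 b + diffWord D b)
    rw [← map_mul, ← sub_eq_zero, ← map_sub, Trunc.mk_eq_zero, diffWord_mul, ← neg_mem_iff]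
    have := theta_mul (diffWord_mem_theta D a) (diffWord_mem_theta D b)
    convert this using 1
    rw [show (single 1 (a * b) : WordAlg S ι) = single 1 a * single 1 b by
      rw [single_mul_single, one_mul]]
    noncomm_ring)

theorem taylorTwo_apply (b : S) :
    taylorTwo D b = Trunc.mk S ι 2 (single 1 b + diffWord D b) := rfl

theorem exists_taylor {R : Type} [Ring R] [Algebra ℂ R] {d : ℕ} (hsm : IsdSmooth R d)
    (π : R →ₐ[ℂ] S) {k : ℕ} (hk : 2 ≤ k) (hkd : k ≤ d + 2) :
    ∃ ρ : R →ₐ[ℂ] Trunc S ι k, ∀ b,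
      ρ b - Trunc.mk S ι k (single 1 (π b) + diffWord D (π b)) ∈ Trunc.filt S ι k 2 := by
  induction k, hk using Nat.le_induction with
  | base =>
    refine ⟨(taylorTwo D).comp π, fun b => ?_⟩
    rw [AlgHom.comp_apply, taylorTwo_apply, sub_self]; exact zero_mem _
  | succ k hk ih =>
    obtain ⟨ρ, hρ⟩ := ih (by omega)
    obtain ⟨ρ', hρ'⟩ := hsm.2 _ _ _ _ _ _ (Trunc.isNCNilpotentOfDegree hkd)
      (Trunc.isNCNilpotentOfDegree (by omega)) _ (Trunc.isCentralExtension_proj (by omega)) ρ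
    refine ⟨ρ', fun b => ?_⟩
    obtain ⟨f, hf⟩ := Trunc.mk_surjective _ (ρ' b)
    have h1 : ρ b = Trunc.mk S ι k f := by
      rw [← hρ', AlgHom.comp_apply, ← hf, Trunc.proj_mk]
    have h2 := hρ b
    rw [h1, ← map_sub] at h2
    rw [← hf, ← map_sub]
    exact Trunc.mk_mem_filt (Trunc.mem_theta_of_mk_mem_filt hk h2)

end Words

section Homogeneous

open MonoidAlgebra

/-- The elements supported on words of length `n`. -/
def homog (S ι : Type) [CommRing S] [Algebra ℂ S] (n : ℕ) : Submodule ℂ (WordAlg S ι) where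
  carrier := {f | ∀ w, w.length ≠ n → f.coeff w = 0}
  zero_mem' := by intro w _; simp
  add_mem' := by intro f g hf hg w hw; simp [hf w hw, hg w hw]
  smul_mem' := by intro c f hf w hw; simp [hf w hw]

variable {S : Type} [CommRing S] [Algebra ℂ S] {ι : Type}

theorem homog_mul {n m : ℕ} {f g : WordAlg S ι} (hf : f ∈ homog S ι n) (hg : g ∈ homog S ι m) :
    f * g ∈ homog S ι (n + m) := by
  classical
  intro w hw
  rw [coeff_mul]
  refine Finset.sum_eq_zero fun a _ => Finset.sum_eq_zero fun b _ => ?_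
  dsimp only
  split_ifs with h
  · rw [← h, FreeMonoid.length_mul] at hw
    by_cases h1 : a.length = n
    · rw [hg b (by omega), mul_zero]
    · rw [hf a h1, zero_mul]
  · rfl

theorem single_mem_homog (w : FreeMonoid ι) (a : S) : single w a ∈ homog S ι w.length := by
  classical
  intro w' hw'
  rw [coeff_single, Finsupp.single_apply, if_neg]
  rintro rfl; exact hw' rfl

theorem homog_le_theta {n : ℕ} {f : WordAlg S ι} (hf : f ∈ homog S ι n) : f ∈ theta S ι n :=
  fun w hw => hf w hw.ne

theorem eq_zero_of_mem_homog_of_mem_theta {n : ℕ} {f : WordAlg S ι} (hf : f ∈ homog S ι n)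
    (h : f ∈ theta S ι (n + 1)) : f = 0 := by
  ext w
  by_cases hw : w.length = n
  · exact h w (by omega)
  · exact hf w hw

theorem homog_commutator {n m : ℕ} {f g : WordAlg S ι} (hf : f ∈ homog S ι n)
    (hg : g ∈ homog S ι m) : f * g - g * f ∈ homog S ι (n + m) :=
  sub_mem (homog_mul hf hg) (add_comm n m ▸ homog_mul hg hf)

theorem smul_mem_homog {n : ℕ} (c : S) {f : WordAlg S ι} (hf : f ∈ homog S ι n) :
    c • f ∈ homog S ι n := by
  intro w hw; rw [coeff_smul_apply, hf w hw, smul_zero]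

variable [Fintype ι] {D : ι → Derivation ℂ S S}

theorem diffWord_mem_homog (D : ι → Derivation ℂ S S) (b : S) : diffWord D b ∈ homog S ι 1 :=
  sum_mem fun i _ => by simpa using single_mem_homog (FreeMonoid.of i) (D i b)

theorem coeff_mul_diffWord (f : WordAlg S ι) (b : S) (w : FreeMonoid ι) (j : ι) :
    (f * diffWord D b).coeff (w * FreeMonoid.of j) = f.coeff w * D j b := by
  classical
  rw [diffWord_apply, Finset.mul_sum, coeff_sum, Finset.sum_apply', Finset.sum_eq_single j]
  · simp
  · intro i _ hi
    refine coeff_mul_single_of_forall_mul_ne _ _ fun d h => hi ?_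
    have := congrArg FreeMonoid.toList h
    exact (show d = w ∧ i = j by simpa using this).2
  · simp

theorem coeff_diffWord_mul (f : WordAlg S ι) (b : S) (w : FreeMonoid ι) (j : ι) :
    (diffWord D b * f).coeff (FreeMonoid.of j * w) = D j b * f.coeff w := by
  classical
  rw [diffWord_apply, Finset.sum_mul, coeff_sum, Finset.sum_apply', Finset.sum_eq_single j]
  · simp
  · intro i _ hi
    refine coeff_single_mul_of_forall_mul_ne _ _ fun d h => hi ?_
    have := congrArg FreeMonoid.toList h
    exact (show i = j ∧ d = w by simpa using this).1
  · simp

theorem eq_zero_of_commute_diffWord (hW : Ideal.span (minorSet D) = ⊤) {q : WordAlg S ι}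
    (hq : q ∈ theta S ι 1) (h : ∀ b, q * diffWord D b = diffWord D b * q) : q = 0 := by
  have key : ∀ w : FreeMonoid ι, ∀ i j b,
      q.coeff (FreeMonoid.of i * w) * D j b = D i b * q.coeff (w * FreeMonoid.of j) := by
    intro w i j b
    rw [← coeff_mul_diffWord, ← coeff_diffWord_mul, h b, mul_assoc]
  ext w
  rcases List.eq_nil_or_concat' (FreeMonoid.toList w) with h1 | ⟨l, j, h1⟩
  · exact hq w (by rw [FreeMonoid.length, h1]; simp)
  obtain rfl : w = FreeMonoid.ofList l * FreeMonoid.of j :=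
    FreeMonoid.toList.injective (by simpa using h1)
  refine eq_zero_of_minorSet_sq_mul hW ?_
  rintro k ⟨a, b, y, y', rfl⟩
  have h2 := fun i j b => key (FreeMonoid.ofList l) i j b
  generalize FreeMonoid.ofList l = w at *
  have e : ∀ j, (D a y * q.coeff (FreeMonoid.of b * w) - D b y * q.coeff (FreeMonoid.of a * w)) *
      D j y = 0 := fun j => by linear_combination D a y * h2 b j y - D b y * h2 a j y
  linear_combination (-(D a y * D b y' - D b y * D a y')) * (D a y * h2 b j y' - D b y * h2 a j y')
    + D b y' * D j y' * e a - D a y' * D j y' * e b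

end Homogeneous

section Frame

variable {R S : Type} [Ring R] [Algebra ℂ R] [CommRing S] [Algebra ℂ S] {ι : Type} [Fintype ι]
  {s : ι → S} {D : ι → Derivation ℂ S S} {π : R →ₐ[ℂ] S} {sec : S →ₗ[ℂ] R}

theorem IsFrame.apply_eq_sum_smul (hD : IsFrame s D) (hsec : ∀ y, π (sec y) = y)
    {N : Type} [AddCommGroup N] [Module R N] (hN : ∀ r, π r = 0 → ∀ x : N, r • x = 0)
    (δ : R →+ N) (hmul : ∀ a b, δ (a * b) = a • δ b + b • δ a) (hker : ∀ a, π a = 0 → δ a = 0)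
    (hc : ∀ c : ℂ, δ (algebraMap ℂ R c) = 0)
    (b : R) : δ b = ∑ i, sec (D i (π b)) • δ (sec (s i)) := by
  have hN' : ∀ r r' : R, π r = π r' → ∀ x : N, r • x = r' • x := fun r r' h x => by
    rw [← sub_eq_zero, ← sub_smul]; exact hN _ (by rw [map_sub, h, sub_self]) x
  have hδ' : ∀ a a', π a = π a' → δ a = δ a' := fun a a' h => by
    rw [← sub_eq_zero, ← map_sub]; exact hker _ (by rw [map_sub, h, sub_self])
  have hδc : ∀ c : ℂ, ∀ x, δ (c • x) = algebraMap ℂ R c • δ x := fun c x => by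
    rw [Algebra.smul_def, hmul, hc, smul_zero, add_zero]
  let _ : Module S N :=
    { smul := fun y x => sec y • x
      one_smul := fun x => (hN' _ 1 (by rw [hsec, map_one]) x).trans (one_smul R x)
      mul_smul := fun y z x =>
        (hN' _ (sec y * sec z) (by rw [map_mul π, hsec, hsec, hsec]) x).trans (mul_smul _ _ x)
      smul_zero := fun y => smul_zero (sec y)
      smul_add := fun y => smul_add (sec y)
      add_smul := fun y z x => by
        change sec (y + z) • x = sec y • x + sec z • x
        rw [map_add, add_smul]
      zero_smul := fun x => by
        change sec 0 • x = 0
        rw [map_zero, zero_smul] }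
  let _ : Module ℂ N := Module.compHom N (algebraMap ℂ S)
  have _ : IsScalarTower ℂ S N := IsScalarTower.of_algebraMap_smul fun _ _ => rfl
  let Δ : Derivation ℂ S N := Derivation.mk'
    { toFun := fun y => δ (sec y)
      map_add' := fun y z => by rw [map_add, map_add]
      map_smul' := fun c y => by
        rw [map_smul, hδc]
        exact hN' _ _ (by rw [hsec, AlgHom.commutes]; rfl) _ }
    (fun y z => by
      change δ (sec (y * z)) = sec y • δ (sec z) + sec z • δ (sec y)
      rw [← hmul]
      exact hδ' _ _ (by rw [map_mul π, hsec, hsec, hsec]))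
  rw [hδ' b (sec (π b)) (by rw [hsec])]
  exact hD.derivation_apply Δ (π b)

theorem IsFrame.commutator_sub_mem (hD : IsFrame s D) (hsec : ∀ y, π (sec y) = y)
    (hπ : IsAbelianization π) {m : ℕ} {z : R} (h : ∀ y, z * y - y * z ∈ commFiltration R m)
    (h2 : ∀ y ∈ commFiltration R 2, z * y - y * z ∈ commFiltration R (m + 1)) (b : R) :
    (z * b - b * z) - ∑ i, sec (D i (π b)) * (z * sec (s i) - sec (s i) * z) ∈
      commFiltration R (m + 1) := by
  let I : ℕ → Submodule R R := fun n =>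
    { carrier := {x | x ∈ commFiltration R n}
      zero_mem' := (commFiltration R n).zero_mem
      add_mem' := fun h h' => (commFiltration R n).add_mem h h'
      smul_mem' := fun r _ h => (commFiltration R n).mul_mem_left r _ h }
  let δ : R →+ I m ⧸ (I (m + 1)).comap (I m).subtype :=
    { toFun := fun y => Submodule.Quotient.mk ⟨z * y - y * z, h y⟩
      map_zero' := by
        rw [Submodule.Quotient.mk_eq_zero]
        change z * 0 - 0 * z ∈ commFiltration R (m + 1)
        simp [(commFiltration R (m + 1)).zero_mem]
      map_add' := fun a b => by
        rw [← Submodule.Quotient.mk_add]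
        congr 2
        change z * (a + b) - (a + b) * z = (z * a - a * z) + (z * b - b * z)
        noncomm_ring }
  have key := hD.apply_eq_sum_smul hsec (N := I m ⧸ (I (m + 1)).comap (I m).subtype) ?_ δ ?_ ?_ ?_ b
  · have e : ∑ i, sec (D i (π b)) • δ (sec (s i)) = Submodule.Quotient.mk
        (∑ i, sec (D i (π b)) • (⟨z * sec (s i) - sec (s i) * z, h _⟩ : I m)) := by
      rw [← Submodule.mkQ_apply, map_sum]; rfl
    rw [e] at key
    have := (Submodule.Quotient.eq _).1 key
    change ((_ - _ : I m) : R) ∈ commFiltration R (m + 1) at this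
    simpa using this
  · intro r hr x
    obtain ⟨⟨x, hx⟩, rfl⟩ := Submodule.Quotient.mk_surjective _ x
    rw [← Submodule.Quotient.mk_smul, Submodule.Quotient.mk_eq_zero]
    change r * x ∈ commFiltration R (m + 1)
    exact commFiltration_antitone (by omega) (commFiltration_mul ((hπ.2 r).1 hr) hx)
  · intro a c
    change Submodule.Quotient.mk _ = a • Submodule.Quotient.mk _ + c • Submodule.Quotient.mk _
    rw [← Submodule.Quotient.mk_smul, ← Submodule.Quotient.mk_smul, ← Submodule.Quotient.mk_add,
      Submodule.Quotient.eq]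
    change (z * (a * c) - a * c * z) - (a * (z * c - c * z) + c * (z * a - a * z)) ∈
      commFiltration R (m + 1)
    have e : (z * (a * c) - a * c * z) - (a * (z * c - c * z) + c * (z * a - a * z)) =
      (z * a - a * z) * c - c * (z * a - a * z) := by noncomm_ring
    rw [e]; exact commutator_mem_succ (h a) c
  · intro a ha
    rw [show δ a = Submodule.Quotient.mk ⟨z * a - a * z, h a⟩ from rfl,
      Submodule.Quotient.mk_eq_zero]
    exact h2 a ((hπ.2 a).1 ha)
  · intro c
    rw [show δ (algebraMap ℂ R c) = Submodule.Quotient.mk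
      ⟨z * algebraMap ℂ R c - algebraMap ℂ R c * z, h _⟩ from rfl, Submodule.Quotient.mk_eq_zero]
    change z * algebraMap ℂ R c - algebraMap ℂ R c * z ∈ commFiltration R (m + 1)
    rw [Algebra.commutes, sub_self]; exact (commFiltration R (m + 1)).zero_mem

end Frame

section Symbols

open MonoidAlgebra

/-- The commutator filtration as a sequence of subspaces. -/
def commSubmodule (R : Type) [Ring R] [Algebra ℂ R] (n : ℕ) : Submodule ℂ R where
  carrier := {x | x ∈ commFiltration R n}
  zero_mem' := (commFiltration R n).zero_mem
  add_mem' := fun h h' => (commFiltration R n).add_mem h h'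
  smul_mem' := fun c _ h => commFiltration_smul c h

theorem isCommFiltered_commSubmodule (R : Type) [Ring R] [Algebra ℂ R] :
    IsCommFiltered (commSubmodule R) where
  zero := eq_top_iff.2 fun x _ => mem_commFiltration_zero x
  anti := fun h _ hx => commFiltration_antitone h hx
  mul := fun hx hy => commFiltration_mul hx hy
  comm := fun b hx => commutator_mem_succ hx b
  comm_two := commutator_mem_two

/-- The homogeneous elements of degree `n` of the free algebra lying in the `n`-th step of its
commutator filtration. -/
def homogComm (ι : Type) (n : ℕ) : Submodule ℂ (WordAlg ℂ ι) :=
  commSubmodule (WordAlg ℂ ι) n ⊓ homog ℂ ι n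

/-- A letter of the free algebra. -/
abbrev letter {ι : Type} (i : ι) : WordAlg ℂ ι := single (FreeMonoid.of i) 1

variable {ι : Type}

theorem one_mem_homogComm : (1 : WordAlg ℂ ι) ∈ homogComm ι 0 :=
  ⟨mem_commFiltration_zero _, by
    rw [one_def]; simpa using single_mem_homog (1 : FreeMonoid ι) (1 : ℂ)⟩

theorem homogComm_mul {n m : ℕ} {p q : WordAlg ℂ ι} (hp : p ∈ homogComm ι n)
    (hq : q ∈ homogComm ι m) : p * q ∈ homogComm ι (n + m) :=
  ⟨commFiltration_mul hp.1 hq.1, homog_mul hp.2 hq.2⟩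

theorem letter_mem_homog (i : ι) : letter i ∈ homog ℂ ι 1 := by
  simpa using single_mem_homog (FreeMonoid.of i) (1 : ℂ)

theorem homogComm_commutator {n : ℕ} {p : WordAlg ℂ ι} (hp : p ∈ homogComm ι n) (i : ι) :
    p * letter i - letter i * p ∈ homogComm ι (n + 1) :=
  ⟨commutator_mem_succ hp.1 _, homog_commutator hp.2 (letter_mem_homog i)⟩

theorem letter_commutator (i j : ι) : letter i * letter j - letter j * letter i ∈ homogComm ι 2 :=
  ⟨commutator_mem_two _ _, homog_commutator (letter_mem_homog i) (letter_mem_homog j)⟩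

variable {R S : Type} [Ring R] [Algebra ℂ R] [CommRing S] [Algebra ℂ S]

/-- Evaluation of noncommutative polynomials. -/
def wordEval (t : ι → R) : WordAlg ℂ ι →ₐ[ℂ] R :=
  MonoidAlgebra.lift ℂ R (FreeMonoid ι) (FreeMonoid.lift t)

theorem wordEval_letter (t : ι → R) (i : ι) : wordEval t (letter i) = t i := by
  simp [wordEval]

theorem wordEval_mem (t : ι → R) {n : ℕ} {p : WordAlg ℂ ι} (hp : p ∈ homogComm ι n) :
    wordEval t p ∈ commFiltration R n :=
  (isCommFiltered_commSubmodule R).map_mem (wordEval t) hp.1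

/-- Extension of scalars of noncommutative polynomials. -/
def wordMap (S ι : Type) [CommRing S] [Algebra ℂ S] : WordAlg ℂ ι →ₐ[ℂ] WordAlg S ι :=
  mapAlgHom (FreeMonoid ι) (Algebra.ofId ℂ S)

theorem wordMap_single (w : FreeMonoid ι) (c : ℂ) :
    wordMap S ι (single w c) = single w (algebraMap ℂ S c) := by
  simp [wordMap, Algebra.ofId_apply]

theorem wordMap_mem_homog {n : ℕ} {p : WordAlg ℂ ι} (hp : p ∈ homog ℂ ι n) :
    wordMap S ι p ∈ homog S ι n := by
  intro w hw
  rw [wordMap, coeff_mapAlgHom, hp w hw, map_zero]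

theorem diffWord_eq_sum_smul [Fintype ι] (D : ι → Derivation ℂ S S) (b : S) :
    diffWord D b = ∑ i, D i b • wordMap S ι (letter i) := by
  simp [diffWord_apply, wordMap_single, smul_single]

/-- The pairs of an element of `R` in the `n`-th step of the commutator filtration and one of its
symbols of degree `n`. -/
def symbolModule (π : R →ₐ[ℂ] S) (t : ι → R) (n : ℕ) : Submodule ℂ (R × WordAlg S ι) :=
  Submodule.span ℂ {X | ∃ r : R, ∃ p ∈ homogComm ι n, X.2 = π r • wordMap S ι p ∧
    X.1 - r * wordEval t p ∈ commFiltration R (n + 1)}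

variable {π : R →ₐ[ℂ] S} {t : ι → R}

theorem mk_mem_symbolModule {n : ℕ} (r : R) {p : WordAlg ℂ ι} (hp : p ∈ homogComm ι n) :
    (r * wordEval t p, π r • wordMap S ι p) ∈ symbolModule π t n :=
  Submodule.subset_span ⟨r, p, hp, rfl, by simp [(commFiltration R (n + 1)).zero_mem]⟩

theorem mk_zero_mem_symbolModule {n : ℕ} {x : R} (hx : x ∈ commFiltration R (n + 1)) :
    (x, (0 : WordAlg S ι)) ∈ symbolModule π t n :=
  Submodule.subset_span ⟨0, 0, zero_mem _, by simp, by simpa using hx⟩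

theorem fst_mem_of_sub_mem {n : ℕ} {x r : R} {p : WordAlg ℂ ι} (hp : p ∈ homogComm ι n)
    (h : x - r * wordEval t p ∈ commFiltration R (n + 1)) : x ∈ commFiltration R n := by
  have := (commFiltration R n).add_mem (commFiltration_antitone (Nat.le_succ n) h)
    ((commFiltration R n).mul_mem_left r _ (wordEval_mem t hp))
  simpa using this

theorem snd_mem_homog {n : ℕ} {X : R × WordAlg S ι} (hX : X ∈ symbolModule π t n) :
    X.2 ∈ homog S ι n := by
  refine (Submodule.span_le (p := (homog S ι n).comap (LinearMap.snd ℂ R (WordAlg S ι)))).2 ?_ hX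
  rintro X ⟨r, p, hp, h, -⟩
  change X.2 ∈ homog S ι n
  rw [h]
  exact smul_mem_homog _ (wordMap_mem_homog hp.2)

theorem symbolModule_mul {n m : ℕ} {X Y : R × WordAlg S ι} (hX : X ∈ symbolModule π t n)
    (hY : Y ∈ symbolModule π t m) : X * Y ∈ symbolModule π t (n + m) := by
  have h := Submodule.mul_mem_mul hX hY
  rw [symbolModule, symbolModule, Submodule.span_mul_span] at h
  refine Submodule.span_mono ?_ h
  rintro _ ⟨X, ⟨r, p, hp, hq, hx⟩, Y, ⟨r', p', hp', hq', hx'⟩, rfl⟩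
  refine ⟨r * r', p * p', homogComm_mul hp hp', ?_, ?_⟩
  · change X.2 * Y.2 = _
    rw [hq, hq', map_mul, map_mul, smul_mul_smul_comm]
  · change X.1 * Y.1 - _ ∈ _
    have e : X.1 * Y.1 - r * r' * wordEval t (p * p') = (X.1 - r * wordEval t p) * Y.1 +
        r * wordEval t p * (Y.1 - r' * wordEval t p') +
        r * (wordEval t p * r' - r' * wordEval t p) * wordEval t p' := by
      rw [map_mul]; noncomm_ring
    have h1 := wordEval_mem t hp
    have h2 := wordEval_mem t hp'
    rw [e]
    refine (commFiltration R _).add_mem ((commFiltration R _).add_mem ?_ ?_) ?_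
    · exact commFiltration_antitone (by omega)
        (commFiltration_mul hx (fst_mem_of_sub_mem hp' hx'))
    · exact commFiltration_antitone (by omega)
        (commFiltration_mul ((commFiltration R n).mul_mem_left r _ h1) hx')
    · exact commFiltration_antitone (by omega) (commFiltration_mul
        ((commFiltration R (n + 1)).mul_mem_left r _ (commutator_mem_succ h1 r')) h2)

variable {sec : S →ₗ[ℂ] R}

/-- Substitution of lifts in a noncommutative polynomial with coefficients in `S`. -/
def liftWord (sec : S →ₗ[ℂ] R) (t : ι → R) : WordAlg S ι →ₗ[ℂ] R :=
  Finsupp.lsum ℂ (fun w => LinearMap.mulRight ℂ (FreeMonoid.lift t w) ∘ₗ sec) ∘ₗ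
    (coeffLinearEquiv ℂ).toLinearMap

theorem liftWord_single (w : FreeMonoid ι) (a : S) :
    liftWord sec t (single w a) = sec a * FreeMonoid.lift t w := by
  simp [liftWord]

theorem liftWord_smul_wordMap (y : S) (p : WordAlg ℂ ι) :
    liftWord sec t (y • wordMap S ι p) = sec y * wordEval t p := by
  induction p using MonoidAlgebra.induction_linear with
  | zero => simp
  | add f g hf hg => rw [map_add, smul_add, map_add, hf, hg, map_add, mul_add]
  | single w c =>
    rw [wordMap_single, smul_single, liftWord_single, wordEval, lift_single, smul_eq_mul, mul_comm,
      ← Algebra.smul_def, map_smul, smul_mul_assoc, mul_smul_comm]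

theorem sub_liftWord_mem (hsec : ∀ y, π (sec y) = y) (hπ : IsAbelianization π) {n : ℕ}
    {X : R × WordAlg S ι} (hX : X ∈ symbolModule π t n) :
    X.1 - liftWord sec t X.2 ∈ commFiltration R (n + 1) := by
  refine (Submodule.span_le (p := (commSubmodule R (n + 1)).comap
    (LinearMap.fst ℂ R (WordAlg S ι) - liftWord sec t ∘ₗ LinearMap.snd ℂ R (WordAlg S ι)))).2 ?_ hX
  rintro X ⟨r, p, hp, hq, hx⟩
  change X.1 - liftWord sec t X.2 ∈ commFiltration R (n + 1)
  rw [hq, liftWord_smul_wordMap]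
  have h1 : r - sec (π r) ∈ commFiltration R 2 := by
    rw [← hπ.2, map_sub, hsec, sub_self]
  have := (commFiltration R (n + 1)).add_mem hx (commFiltration_antitone (by omega)
    (commFiltration_mul h1 (wordEval_mem t hp)))
  rw [sub_mul] at this
  simpa using this

theorem fst_mem_succ_of_snd_eq_zero (hsec : ∀ y, π (sec y) = y) (hπ : IsAbelianization π) {n : ℕ}
    {x : R} (hx : (x, (0 : WordAlg S ι)) ∈ symbolModule π t n) : x ∈ commFiltration R (n + 1) := by
  simpa using sub_liftWord_mem hsec hπ hx

variable [Fintype ι] {D : ι → Derivation ℂ S S}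

theorem smul_commutator_diffWord (y b : S) (p : WordAlg ℂ ι) :
    y • wordMap S ι p * diffWord D b - diffWord D b * y • wordMap S ι p =
      ∑ i, (D i b * y) • wordMap S ι (p * letter i - letter i * p) := by
  rw [diffWord_eq_sum_smul, Finset.mul_sum, Finset.sum_mul, ← Finset.sum_sub_distrib]
  refine Finset.sum_congr rfl fun i _ => ?_
  rw [map_sub, map_mul, map_mul, smul_mul_smul_comm, smul_mul_smul_comm, smul_sub, mul_comm y]

theorem symbolModule_commutator {s : ι → S} (hD : IsFrame s D) (hsec : ∀ y, π (sec y) = y)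
    (hπ : IsAbelianization π) {n : ℕ} {X : R × WordAlg S ι}
    (hX : X ∈ symbolModule π (fun i => sec (s i)) n) (b : R) :
    X * (b, diffWord D (π b)) - (b, diffWord D (π b)) * X ∈
      symbolModule π (fun i => sec (s i)) (n + 1) := by
  set t : ι → R := fun i => sec (s i) with ht
  refine (Submodule.span_le (p := (symbolModule π t (n + 1)).comap
    (LinearMap.mulRight ℂ (b, diffWord D (π b)) - LinearMap.mulLeft ℂ (b, diffWord D (π b))))).2
    ?_ hX
  rintro ⟨x, q⟩ ⟨r, p, hp, rfl, hx⟩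
  change ((x * b - b * x, _ - _) : R × WordAlg S ι) ∈ symbolModule π t (n + 1)
  dsimp only at hx ⊢
  have hz := (commFiltration R n).mul_mem_left r _ (wordEval_mem t hp)
  have key := hD.commutator_sub_mem hsec hπ (m := n + 1) (fun y => commutator_mem_succ hz y)
    (fun y hy => (commFiltration R _).sub_mem
      (commFiltration_antitone (by omega) (commFiltration_mul hz hy))
      (commFiltration_antitone (by omega) (commFiltration_mul hy hz))) b
  have h1 : (x * b - b * x) - ∑ i, sec (D i (π b)) * r *
      wordEval t (p * letter i - letter i * p) ∈ commFiltration R (n + 1 + 1) := by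
    have e : (x * b - b * x) - ∑ i, sec (D i (π b)) * r *
        wordEval t (p * letter i - letter i * p) =
        ((x - r * wordEval t p) * b - b * (x - r * wordEval t p)) +
        (((r * wordEval t p) * b - b * (r * wordEval t p)) - ∑ i, sec (D i (π b)) *
          ((r * wordEval t p) * sec (s i) - sec (s i) * (r * wordEval t p))) +
        ∑ i, sec (D i (π b)) * ((r * sec (s i) - sec (s i) * r) * wordEval t p) := by
      have : ∀ i, sec (D i (π b)) * r * wordEval t (p * letter i - letter i * p) =
          sec (D i (π b)) * ((r * wordEval t p) * sec (s i) - sec (s i) * (r * wordEval t p)) -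
          sec (D i (π b)) * ((r * sec (s i) - sec (s i) * r) * wordEval t p) := by
        intro i
        rw [map_sub, map_mul, map_mul, wordEval_letter, ht]
        noncomm_ring
      simp only [this, Finset.sum_sub_distrib]
      noncomm_ring
    rw [e]
    refine (commFiltration R _).add_mem ((commFiltration R _).add_mem
      (commutator_mem_succ hx b) key) ?_
    refine (commSubmodule R _).sum_mem fun i _ => (commFiltration R _).mul_mem_left _ _ ?_
    exact commFiltration_antitone (by omega)
      (commFiltration_mul (commutator_mem_two r (sec (s i))) (wordEval_mem t hp))
  have h2 := (symbolModule π t (n + 1)).add_mem (mk_zero_mem_symbolModule h1)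
    ((symbolModule π t (n + 1)).sum_mem (t := Finset.univ) fun i _ =>
      mk_mem_symbolModule (sec (D i (π b)) * r) (homogComm_commutator hp i))
  convert h2 using 1
  refine Prod.ext ?_ ?_
  · simp [Prod.fst_sum]
  · simp only [Prod.snd_add, Prod.snd_sum, zero_add, map_mul π, hsec]
    exact smul_commutator_diffWord _ _ _

theorem commutator_mem_symbolModule {s : ι → S} (hD : IsFrame s D) (hsec : ∀ y, π (sec y) = y)
    (hπ : IsAbelianization π) (a b : R) :
    ((a * b - b * a, diffWord D (π a) * diffWord D (π b) - diffWord D (π b) * diffWord D (π a)) :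
      R × WordAlg S ι) ∈ symbolModule π (fun i => sec (s i)) 2 := by
  set t : ι → R := fun i => sec (s i) with ht
  have key : ∀ z y : R, (z * y - y * z) - ∑ i, sec (D i (π y)) * (z * t i - t i * z) ∈
      commFiltration R 3 := fun z y =>
    hD.commutator_sub_mem hsec hπ (m := 2) (commutator_mem_two z)
      (fun y hy => by
        have := (commFiltration R 3).neg_mem (commutator_mem_succ hy z)
        simpa using this) y
  have h1 : (a * b - b * a) - ∑ i, ∑ j, sec (D i (π b)) * sec (D j (π a)) *
      wordEval t (letter j * letter i - letter i * letter j) ∈ commFiltration R 3 := by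
    have e : (a * b - b * a) - ∑ i, ∑ j, sec (D i (π b)) * sec (D j (π a)) *
        wordEval t (letter j * letter i - letter i * letter j) =
        ((a * b - b * a) - ∑ i, sec (D i (π b)) * (a * t i - t i * a)) -
        ∑ i, sec (D i (π b)) * ((t i * a - a * t i) -
          ∑ j, sec (D j (π a)) * (t i * t j - t j * t i)) := by
      simp only [mul_sub, Finset.mul_sum, Finset.sum_sub_distrib, map_sub, map_mul,
        wordEval_letter, mul_assoc]
      abel
    rw [e]
    exact (commFiltration R _).sub_mem (key a b) ((commSubmodule R _).sum_mem fun i _ =>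
      (commFiltration R _).mul_mem_left _ _ (key (t i) a))
  have h2 := (symbolModule π t 2).add_mem (mk_zero_mem_symbolModule h1)
    ((symbolModule π t 2).sum_mem (t := Finset.univ) fun i _ =>
      (symbolModule π t 2).sum_mem (t := Finset.univ) fun j _ =>
      mk_mem_symbolModule (sec (D i (π b)) * sec (D j (π a))) (letter_commutator j i))
  convert h2 using 1
  refine Prod.ext ?_ ?_
  · simp [Prod.fst_sum]
  · simp only [Prod.snd_add, Prod.snd_sum, zero_add, map_mul π, hsec]
    rw [diffWord_eq_sum_smul D (π a), Finset.sum_mul, Finset.mul_sum, ← Finset.sum_sub_distrib,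
      Finset.sum_comm]
    exact Finset.sum_congr rfl fun j _ => smul_commutator_diffWord _ _ _

end Symbols

section Center

open MonoidAlgebra

variable {R S : Type} [Ring R] [Algebra ℂ R] [CommRing S] [Algebra ℂ S] {ι : Type}

/-- The pairs of an element and a symbol which is also the leading term of the image of the element
under a homomorphism to a truncated free algebra. -/
def leadingModule {k : ℕ} (π : R →ₐ[ℂ] S) (t : ι → R) (ρ : R →ₐ[ℂ] Trunc S ι k) (n : ℕ) :
    Submodule ℂ (R × WordAlg S ι) :=
  symbolModule π t n ⊓ (Trunc.filt S ι k (n + 1)).comap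
    (ρ.toLinearMap ∘ₗ LinearMap.fst ℂ R (WordAlg S ι) -
      (Trunc.mk S ι k).toLinearMap ∘ₗ LinearMap.snd ℂ R (WordAlg S ι))

variable {k : ℕ} {π : R →ₐ[ℂ] S} {t : ι → R} {ρ : R →ₐ[ℂ] Trunc S ι k}

theorem snd_mem_filt {n : ℕ} {X : R × WordAlg S ι} (hX : X ∈ symbolModule π t n) :
    Trunc.mk S ι k X.2 ∈ Trunc.filt S ι k n :=
  Trunc.mk_mem_filt (homog_le_theta (snd_mem_homog hX))

theorem map_fst_mem_filt {n : ℕ} {X : R × WordAlg S ι} (hX : X ∈ leadingModule π t ρ n) :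
    ρ X.1 ∈ Trunc.filt S ι k n := by
  simpa using add_mem ((Trunc.isCommFiltered k).anti (Nat.le_succ n) hX.2) (snd_mem_filt hX.1)

theorem leadingModule_mul {n m : ℕ} {X Y : R × WordAlg S ι} (hX : X ∈ leadingModule π t ρ n)
    (hY : Y ∈ leadingModule π t ρ m) : X * Y ∈ leadingModule π t ρ (n + m) := by
  refine ⟨symbolModule_mul hX.1 hY.1, ?_⟩
  change ρ (X.1 * Y.1) - Trunc.mk S ι k (X.2 * Y.2) ∈ Trunc.filt S ι k (n + m + 1)
  have e : ρ (X.1 * Y.1) - Trunc.mk S ι k (X.2 * Y.2) =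
      (ρ X.1 - Trunc.mk S ι k X.2) * ρ Y.1 + Trunc.mk S ι k X.2 * (ρ Y.1 - Trunc.mk S ι k Y.2) := by
    rw [map_mul, map_mul]; noncomm_ring
  rw [e]
  have hF := Trunc.isCommFiltered (S := S) (ι := ι) k
  exact add_mem (hF.anti (by omega) (hF.mul hX.2 (map_fst_mem_filt hY)))
    (hF.anti (by omega) (hF.mul (snd_mem_filt hX.1) hY.2))

variable [Fintype ι] {D : ι → Derivation ℂ S S}

theorem commutator_sub_mem_filt {n : ℕ} {q : WordAlg S ι} {x b : R} {a c : S}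
    (hx : ρ x - Trunc.mk S ι k (single 1 a + q) ∈ Trunc.filt S ι k (n + 1)) (hq : q ∈ theta S ι n)
    (hb : ρ b - Trunc.mk S ι k (single 1 c + diffWord D c) ∈ Trunc.filt S ι k 2) :
    ρ (x * b - b * x) - Trunc.mk S ι k (q * diffWord D c - diffWord D c * q) ∈
      Trunc.filt S ι k (n + 2) := by
  have hF := Trunc.isCommFiltered (S := S) (ι := ι) k
  have hc : ∀ (a : S) (g : Trunc S ι k),
      Trunc.mk S ι k (single 1 a) * g - g * Trunc.mk S ι k (single 1 a) = 0 := fun a g => by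
    obtain ⟨g, rfl⟩ := Trunc.mk_surjective k g
    rw [← map_mul, ← map_mul, single_one_comm, sub_self]
  have hQ := Trunc.mk_mem_filt (k := k) hq
  have e : ρ (x * b - b * x) - Trunc.mk S ι k (q * diffWord D c - diffWord D c * q) =
      ((ρ x - Trunc.mk S ι k (single 1 a + q)) * ρ b -
        ρ b * (ρ x - Trunc.mk S ι k (single 1 a + q))) +
      (Trunc.mk S ι k q * (ρ b - Trunc.mk S ι k (single 1 c + diffWord D c)) -
        (ρ b - Trunc.mk S ι k (single 1 c + diffWord D c)) * Trunc.mk S ι k q) +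
      (Trunc.mk S ι k (single 1 a) * ρ b - ρ b * Trunc.mk S ι k (single 1 a)) -
      (Trunc.mk S ι k (single 1 c) * Trunc.mk S ι k q -
        Trunc.mk S ι k q * Trunc.mk S ι k (single 1 c)) := by
    simp only [map_sub, map_mul, map_add]; noncomm_ring
  rw [e, hc, hc, add_zero, sub_zero]
  exact add_mem (hF.comm (ρ b) hx) (sub_mem (hF.mul hQ hb) (hF.anti (by omega) (hF.mul hb hQ)))

/-- A homomorphism to a truncated free algebra extending the first-order Taylor map. -/
def IsTaylor (π : R →ₐ[ℂ] S) (D : ι → Derivation ℂ S S) (ρ : R →ₐ[ℂ] Trunc S ι k) : Prop :=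
  ∀ b, ρ b - Trunc.mk S ι k (single 1 (π b) + diffWord D (π b)) ∈ Trunc.filt S ι k 2

theorem IsTaylor.exists_leading (hρ : IsTaylor π D ρ) {s : ι → S} {sec : S →ₗ[ℂ] R}
    (hD : IsFrame s D) (hsec : ∀ y, π (sec y) = y) (hπ : IsAbelianization π) {n : ℕ} {x : R}
    (hx : x ∈ commFiltration R n) : ∃ q, (x, q) ∈ leadingModule π (fun i => sec (s i)) ρ n := by
  set t : ι → R := fun i => sec (s i) with ht
  have hF := Trunc.isCommFiltered (S := S) (ι := ι) k
  have hl : ∀ i, ∀ a ∈ lieLCS R (i + 1), ∃ q, (a, q) ∈ leadingModule π t ρ (i + 2) := by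
    intro i
    induction i with
    | zero =>
      intro a ha
      have h : a ∈ (leadingModule π t ρ 2).map (LinearMap.fst ℂ R (WordAlg S ι)) := by
        refine (Submodule.span_le.2 ?_) ha
        rintro _ ⟨a, -, b, rfl⟩
        exact ⟨(_, _), ⟨commutator_mem_symbolModule hD hsec hπ a b,
          commutator_sub_mem_filt (n := 1) (hρ a) (diffWord_mem_theta D _) (hρ b)⟩, rfl⟩
      obtain ⟨⟨_, q⟩, hq, rfl⟩ := h
      exact ⟨q, hq⟩
    | succ i ih =>
      intro a ha
      have h : a ∈ (leadingModule π t ρ (i + 1 + 2)).map (LinearMap.fst ℂ R (WordAlg S ι)) := by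
        refine (Submodule.span_le.2 ?_) ha
        rintro _ ⟨a, ha, b, rfl⟩
        obtain ⟨q, hq⟩ := ih a ha
        refine ⟨(_, _), ⟨symbolModule_commutator hD hsec hπ hq.1 b,
          commutator_sub_mem_filt (n := i + 2) (a := 0) ?_
            (homog_le_theta (snd_mem_homog hq.1)) (hρ b)⟩, rfl⟩
        rw [single_zero, zero_add]
        exact hq.2
      obtain ⟨⟨_, q⟩, hq, rfl⟩ := h
      exact ⟨q, hq⟩
  have h0 : ∀ r, (r, single 1 (π r)) ∈ leadingModule π t ρ 0 := by
    intro r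
    refine ⟨?_, ?_⟩
    · have := mk_mem_symbolModule (π := π) (t := t) r one_mem_homogComm
      rwa [map_one, map_one, mul_one, one_def, smul_single, smul_eq_mul, mul_one] at this
    · change ρ r - Trunc.mk S ι k (single 1 (π r)) ∈ Trunc.filt S ι k 1
      have := add_mem (hF.anti one_le_two (hρ r))
        (Trunc.mk_mem_filt (k := k) (diffWord_mem_theta D (π r)))
      rwa [map_add, ← sub_sub, sub_add_cancel] at this
  have hw : ∀ m y, CommWord m y → ∃ q, (y, q) ∈ leadingModule π t ρ m := by
    intro m y hy
    induction hy with
    | base r => exact ⟨_, h0 r⟩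
    | step r a y i m ha _ ih =>
      obtain ⟨q, hq⟩ := ih
      obtain ⟨q', hq'⟩ := hl i a ha
      have := leadingModule_mul (leadingModule_mul (h0 r) hq') hq
      rw [show 0 + (i + 2) + m = m + i + 2 by omega] at this
      exact ⟨_, this⟩
  have h : x ∈ (leadingModule π t ρ n).map (LinearMap.fst ℂ R (WordAlg S ι)) := by
    refine commFiltration_induction
      ((leadingModule π t ρ n).map (LinearMap.fst ℂ R (WordAlg S ι))).toAddSubgroup ?_ hx
    intro m y hm hy
    rcases hm.eq_or_lt with rfl | hm
    · obtain ⟨q, hq⟩ := hw _ y hy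
      exact ⟨_, hq, rfl⟩
    · have hy' : y ∈ commFiltration R (n + 1) := commFiltration_antitone hm hy.mem
      refine ⟨(y, 0), ⟨mk_zero_mem_symbolModule hy', ?_⟩, rfl⟩
      change ρ y - Trunc.mk S ι k 0 ∈ Trunc.filt S ι k (n + 1)
      rw [map_zero, sub_zero]
      exact hF.map_mem ρ hy'
  obtain ⟨⟨_, q⟩, hq, rfl⟩ := h
  exact ⟨q, hq⟩

theorem IsTaylor.eq_zero_of_mem_center (hρ : IsTaylor π D ρ)
    (hW : Ideal.span (minorSet D) = ⊤) (hπ : Function.Surjective π) {n : ℕ} (hn : 1 ≤ n)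
    (hnk : n + 2 ≤ k) {x : R} (hx : x ∈ Subring.center R) {q : WordAlg S ι}
    (hq : q ∈ homog S ι n) {a : S}
    (h : ρ x - Trunc.mk S ι k (single 1 a + q) ∈ Trunc.filt S ι k (n + 1)) : q = 0 := by
  refine eq_zero_of_commute_diffWord hW (theta_anti hn (homog_le_theta hq)) fun c => ?_
  obtain ⟨b, rfl⟩ := hπ c
  have h1 := commutator_sub_mem_filt h (homog_le_theta hq) (hρ b)
  rw [(Subring.mem_center_iff.1 hx b), sub_self, map_zero, zero_sub, neg_mem_iff] at h1
  rw [← sub_eq_zero]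
  exact eq_zero_of_mem_homog_of_mem_theta (homog_commutator hq (diffWord_mem_homog D (π b)))
    (Trunc.mem_theta_of_mk_mem_filt hnk h1)

end Center

end NCGeom

open NCGeom in
/-- Let `d ≥ 1` and let `R` be a `d`-smooth `ℂ`-algebra such that the
abelianization `R^{ab}` (presented by a surjection `π : R → S` with kernel `I₂R` onto a
commutative algebra of finite type) has Krull dimension `≥ 2` and connected spectrum.
Then the center of `R` equals `ℂ·1 + I_{d+1}R`. -/
theorem center_of_dSmooth (d : ℕ) (hd : 1 ≤ d)
    (R : Type) [Ring R] [Algebra ℂ R] (hsm : IsdSmooth R d)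
    (S : Type) [CommRing S] [Algebra ℂ S] [Algebra.FiniteType ℂ S]
    (π : R →ₐ[ℂ] S) (hπ : IsAbelianization π)
    (hdim : 2 ≤ ringKrullDim S)
    (hconn : ConnectedSpace (PrimeSpectrum S)) :
    ∀ x : R, x ∈ Subring.center R ↔
      ∃ c : ℂ, x - algebraMap ℂ R c ∈ commFiltration R (d + 1) := by
  intro x
  constructor
  · intro hx
    have := formallySmooth_of_isdSmooth hsm π hπ
    obtain ⟨ι, _, s, D, hD⟩ : ∃ (ι : Type) (_ : Fintype ι) (s : ι → S)
      (D : ι → Derivation ℂ S S), IsFrame s D := exists_differential_frame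
    have hW := IsFrame.span_minorSet_eq_top hD hdim hconn
    obtain ⟨sec, hsec⟩ := π.toLinearMap.exists_rightInverse_of_surjective
      (LinearMap.range_eq_top.2 hπ.1)
    have hsec : ∀ y, π (sec y) = y := fun y => LinearMap.congr_fun hsec y
    obtain ⟨ρ, hρ⟩ := exists_taylor D hsm π (k := d + 2) (by omega) le_rfl
    have hρ : IsTaylor π D ρ := hρ
    have h1 : diffWord D (π x) = 0 :=
      hρ.eq_zero_of_mem_center hW hπ.1 le_rfl (by omega) hx (diffWord_mem_homog D _) (hρ x)
    have h2 : ∀ i, D i (π x) = 0 := fun i => by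
      simpa [h1] using (coeff_mul_diffWord (D := D) 1 (π x) 1 i).symm
    obtain ⟨c, hc⟩ := IsFrame.exists_eq_algebraMap hD hconn h2
    refine ⟨c, ?_⟩
    have hx' : x - algebraMap ℂ R c ∈ Subring.center R :=
      sub_mem hx (Subring.mem_center_iff.2 fun y => (Algebra.commutes c y).symm)
    suffices ∀ n, 1 ≤ n → n ≤ d → x - algebraMap ℂ R c ∈ commFiltration R (n + 1) from
      this d hd le_rfl
    intro n hn
    induction n, hn using Nat.le_induction with
    | base =>
      intro _
      rw [one_add_one_eq_two, ← hπ.2, map_sub, AlgHom.commutes, hc, sub_self]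
    | succ n hn ih =>
      intro hnd
      obtain ⟨q, hq⟩ := hρ.exists_leading hD hsec hπ (ih (by omega))
      have hq0 : q = 0 := by
        refine hρ.eq_zero_of_mem_center (n := n + 1) (a := 0) hW hπ.1 (by omega) (by omega) hx'
          (snd_mem_homog hq.1) ?_
        rw [MonoidAlgebra.single_zero, zero_add]
        exact hq.2
      subst hq0
      exact fst_mem_succ_of_snd_eq_zero hsec hπ hq.1
  · rintro ⟨c, hc⟩
    rw [Subring.mem_center_iff]
    intro b
    have h := hsm.1 _ (commutator_mem_succ hc b)
    rw [sub_mul, mul_sub, Algebra.commutes c b] at h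
    rw [eq_comm, ← sub_eq_zero]
    simpa using h
end
end

section
/- Let A' be an NC-nilpotent algebra of degree d and A = A'/I_{d+1}A'. Then for every central extension 0 → I → Λ' →p→ Λ → 0 with Λ' ∈ N_d, Λ ∈ N_{d−1}, and every algebra homomorphism f: A' → Λ, there is a natural transitive action of the group Der(A^{ab}, I) on the fiber of the map h_{A'}(p): h_{A'}(Λ') → h_{A'}(Λ) over the conjugacy class of f (where h_{A'}(B) is the set of conjugacy classes of homomorphisms A' → B), given by adding a derivation to a lifting; and the action on any element of this fiber induces a bijection coker(Δ_f) → h_{A'}(p)⁻¹([f]). -/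
noncomputable section

open scoped BigOperators

namespace NCGeom

variable {A' Λ' Λ : Type} [Ring A'] [Algebra ℂ A'] [Ring Λ'] [Algebra ℂ Λ'] [Ring Λ] [Algebra ℂ Λ]

/-- `D : A' → Λ'` is a derivation of `A'` with values in the central square-zero ideal
`I = ker p`, relative to `f : A' → Λ` (Leibniz rule through arbitrary lifts; since `I` is
central with `I² = 0` this encodes exactly `Der(A^{ab}, I)`). -/
def IsCentralDerivation (p : Λ' →ₐ[ℂ] Λ) (f : A' →ₐ[ℂ] Λ) (D : A' →ₗ[ℂ] Λ') : Prop :=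
  (∀ a : A', p (D a) = 0) ∧
  ∀ x y : A', ∀ lx ly : Λ', p lx = f x → p ly = f y →
    D (x * y) = D x * ly + lx * D y

/-- `D` is the derivation `Δ_f(u) : a ↦ [ũ, f(a)~]·ũ⁻¹` attached to a unit `u` commuting with
the image of `f` (the value is independent of the choices of lifts `ũ`, `ũ⁻¹~`, `f(a)~`). -/
def IsDeltaF (p : Λ' →ₐ[ℂ] Λ) (f : A' →ₐ[ℂ] Λ) (u : Λˣ) (D : A' →ₗ[ℂ] Λ') : Prop :=
  ∀ a : A', ∀ ut vt fa : Λ', p ut = ↑u → p vt = ↑u⁻¹ → p fa = f a →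
    D a = (ut * fa - fa * ut) * vt

end NCGeom

namespace NCGeom

variable {A' Λ' Λ : Type} [Ring A'] [Algebra ℂ A'] [Ring Λ'] [Algebra ℂ Λ'] [Ring Λ] [Algebra ℂ Λ]

namespace IsCentralExtension

variable {p : Λ' →ₐ[ℂ] Λ}

theorem mul_left_congr (hp : IsCentralExtension p) {x a b : Λ'} (hx : p x = 0)
    (hab : p a = p b) : x * a = x * b := by
  rw [← sub_eq_zero, ← mul_sub]
  exact hp.sq_zero _ _ hx (by rw [map_sub, hab, sub_self])

theorem mul_right_congr (hp : IsCentralExtension p) {x a b : Λ'} (hx : p x = 0)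
    (hab : p a = p b) : a * x = b * x := by
  rw [← hp.central x hx a, ← hp.central x hx b, hp.mul_left_congr hx hab]

theorem commutator_congr (hp : IsCentralExtension p) {a a' b b' : Λ'} (ha : p a = p a')
    (hb : p b = p b') : a * b - b * a = a' * b' - b' * a' := by
  have h₁ := hp.central (a - a') (by rw [map_sub, ha, sub_self]) b
  have h₂ := hp.central (b - b') (by rw [map_sub, hb, sub_self]) a'
  linear_combination (norm := noncomm_ring) h₁ - h₂

theorem mul_two_sub_self_eq_one (hp : IsCentralExtension p) {y : Λ'} (hy : p y = 1) :
    y * (2 - y) = 1 ∧ (2 - y) * y = 1 := by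
  have h := hp.sq_zero (y - 1) (y - 1) (by simp [hy]) (by simp [hy])
  constructor
  · linear_combination (norm := noncomm_ring) -h
  · linear_combination (norm := noncomm_ring) -h

theorem exists_unit_lift (hp : IsCentralExtension p) (u : Λˣ) :
    ∃ w : Λ'ˣ, p w = u ∧ p ↑w⁻¹ = ↑u⁻¹ := by
  obtain ⟨a, ha⟩ := hp.surjective u
  obtain ⟨b, hb⟩ := hp.surjective ↑u⁻¹
  have hr : a * (b * (2 - a * b)) = 1 := by
    rw [← mul_assoc]
    exact (hp.mul_two_sub_self_eq_one (by simp [ha, hb])).1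
  have hl : ((2 - b * a) * b) * a = 1 := by
    rw [mul_assoc]
    exact (hp.mul_two_sub_self_eq_one (by simp [ha, hb])).2
  have h := left_inv_eq_right_inv hl hr
  refine ⟨⟨a, b * (2 - a * b), hr, h ▸ hl⟩, ha, ?_⟩
  simp only [Units.inv_mk, map_mul, map_sub, ha, hb, Units.mul_inv, map_ofNat]
  norm_num

end IsCentralExtension

theorem Conjugate.symm {A B : Type} [Ring A] [Algebra ℂ A] [Ring B] [Algebra ℂ B]
    {f g : A →ₐ[ℂ] B} (h : Conjugate f g) : Conjugate g f := by
  obtain ⟨u, hu⟩ := h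
  exact ⟨u⁻¹, fun a => by simp [hu, mul_assoc]⟩

/-- The algebra homomorphism `a ↦ u * f a * u⁻¹`. -/
def conjHom {A B : Type} [Ring A] [Algebra ℂ A] [Ring B] [Algebra ℂ B]
    (u : Bˣ) (f : A →ₐ[ℂ] B) : A →ₐ[ℂ] B :=
  AlgHom.ofLinearMap
    ((LinearMap.mulRight ℂ (↑u⁻¹ : B)).comp ((LinearMap.mulLeft ℂ (u : B)).comp f.toLinearMap))
    (by simp) (by simp [mul_assoc])

theorem conjHom_apply {A B : Type} [Ring A] [Algebra ℂ A] [Ring B] [Algebra ℂ B]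
    (u : Bˣ) (f : A →ₐ[ℂ] B) (a : A) : conjHom u f a = u * f a * ↑u⁻¹ := rfl

variable {p : Λ' →ₐ[ℂ] Λ} {f : A' →ₐ[ℂ] Λ}

theorem IsCentralDerivation.exists_add (hp : IsCentralExtension p) {f' : A' →ₐ[ℂ] Λ'}
    (hf' : p.comp f' = f) {D : A' →ₗ[ℂ] Λ'} (hD : IsCentralDerivation p f D) :
    ∃ g' : A' →ₐ[ℂ] Λ', (∀ a, g' a = f' a + D a) ∧ p.comp g' = f := by
  have hpf (a : A') : p (f' a) = f a := DFunLike.congr_fun hf' a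
  have hD1 : D 1 = 0 := by
    simpa using hD.2 1 1 1 1 (by simp) (by simp)
  refine ⟨AlgHom.ofLinearMap (f'.toLinearMap + D) (by simp [hD1]) fun x y => ?_,
    fun a => rfl, ?_⟩
  · have h := hp.sq_zero _ _ (hD.1 x) (hD.1 y)
    simp only [LinearMap.add_apply, AlgHom.toLinearMap_apply, map_mul,
      hD.2 x y _ _ (hpf x) (hpf y)]
    linear_combination (norm := noncomm_ring) -h
  · ext a
    simp [hpf, hD.1]

theorem isCentralDerivation_sub (hp : IsCentralExtension p) {f' g' : A' →ₐ[ℂ] Λ'}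
    (hf' : ∀ a, p (f' a) = f a) (hg' : ∀ a, p (g' a) = f a) :
    IsCentralDerivation p f (g'.toLinearMap - f'.toLinearMap) := by
  have h0 (a : A') : p (g' a - f' a) = 0 := by rw [map_sub, hf', hg', sub_self]
  refine ⟨h0, fun x y lx ly hx hy => ?_⟩
  simp only [LinearMap.sub_apply, AlgHom.toLinearMap_apply, map_mul]
  rw [hp.mul_left_congr (h0 x) (hy.trans (hg' y).symm),
    hp.mul_right_congr (h0 y) (hx.trans (hf' x).symm)]
  noncomm_ring

theorem isDeltaF_iff (hp : IsCentralExtension p) {f' : A' →ₐ[ℂ] Λ'}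
    (hf' : ∀ a, p (f' a) = f a) {u : Λˣ} (hu : ∀ a : A', ↑u * f a = f a * ↑u) {w : Λ'ˣ}
    (hw : p w = u) (hw' : p ↑w⁻¹ = ↑u⁻¹) {D : A' →ₗ[ℂ] Λ'} :
    IsDeltaF p f u D ↔ ∀ a, f' a + D a = w * f' a * ↑w⁻¹ := by
  have key (a : A') : w * f' a * ↑w⁻¹ = f' a + (w * f' a - f' a * w) * ↑w⁻¹ := by
    simp [sub_mul]
  simp only [key, add_right_inj]
  refine ⟨fun h a => h a _ _ _ hw hw' (hf' a), fun h a ut vt fa hut hvt hfa => ?_⟩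
  rw [h a, hp.commutator_congr (hw.trans hut.symm) ((hf' a).trans hfa.symm)]
  refine hp.mul_left_congr ?_ (hw'.trans hvt.symm)
  rw [map_sub, map_mul, map_mul, hut, hfa, hu, sub_self]

end NCGeom

open NCGeom in
/-- Let `A'` be NC-nilpotent of degree `d` and `A = A'/I_{d+1}A'`.
For every central extension `0 → I → Λ' → Λ → 0` with `Λ' ∈ 𝒩_d`, `Λ ∈ 𝒩_{d-1}` and every
homomorphism `f : A' → Λ`, the group `Der(A^{ab}, I)` acts transitively on the fiber of
`h_{A'}(p) : h_{A'}(Λ') → h_{A'}(Λ)` over the conjugacy class `[f]` by adding a derivation to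
a lifting, and the action on any element induces a bijection `coker(Δ_f) ≃ h_{A'}(p)⁻¹([f])`. -/
theorem der_action_on_fiber (d : ℕ) (hd : 1 ≤ d)
    (A' : Type) [Ring A'] [Algebra ℂ A'] (hA' : IsNCNilpotentOfDegree A' d)
    (A : Type) [Ring A] [Algebra ℂ A] (ρ : A' →ₐ[ℂ] A)
    (hρ : Function.Surjective ρ ∧ ∀ x : A', ρ x = 0 ↔ x ∈ commFiltration A' (d + 1))
    (Λ' Λ : Type) [Ring Λ'] [Algebra ℂ Λ'] [Ring Λ] [Algebra ℂ Λ]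
    (hΛ' : IsNCNilpotentOfDegree Λ' d) (hΛ : IsNCNilpotentOfDegree Λ (d - 1))
    (p : Λ' →ₐ[ℂ] Λ) (hp : IsCentralExtension p)
    (f : A' →ₐ[ℂ] Λ) :
    -- (a) adding a central derivation to a lifting of `f` produces a lifting of `f`:
    (∀ f' : A' →ₐ[ℂ] Λ', p.comp f' = f → ∀ D : A' →ₗ[ℂ] Λ', IsCentralDerivation p f D →
      ∃ g' : A' →ₐ[ℂ] Λ', (∀ a, g' a = f' a + D a) ∧ p.comp g' = f) ∧
    -- (b) transitivity of the action on the fiber over `[f]`: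
    (∀ f' : A' →ₐ[ℂ] Λ', p.comp f' = f →
      ∀ g' : A' →ₐ[ℂ] Λ', Conjugate (p.comp g') f →
        ∃ D : A' →ₗ[ℂ] Λ', IsCentralDerivation p f D ∧
          ∃ g'' : A' →ₐ[ℂ] Λ', (∀ a, g'' a = f' a + D a) ∧ Conjugate g'' g') ∧
    -- (c) the stabilizer of any element is exactly the image of `Δ_f : U(f) → Der(A^{ab},I)`,
    -- so the orbit map induces a bijection `coker(Δ_f) ≃ h_{A'}(p)⁻¹([f])`:
    (∀ f' : A' →ₐ[ℂ] Λ', p.comp f' = f →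
      ∀ D : A' →ₗ[ℂ] Λ', IsCentralDerivation p f D →
        ∀ g' : A' →ₐ[ℂ] Λ', (∀ a, g' a = f' a + D a) →
          (Conjugate g' f' ↔
            ∃ u : Λˣ, (∀ a : A', ↑u * f a = f a * ↑u) ∧ IsDeltaF p f u D)) := by
  have hpf {f' : A' →ₐ[ℂ] Λ'} (hf' : p.comp f' = f) (a : A') : p (f' a) = f a :=
    DFunLike.congr_fun hf' a
  refine ⟨fun f' hf' D hD => hD.exists_add hp hf', fun f' hf' g' ⟨u, hu⟩ => ?_,
    fun f' hf' D hD g' hg' => ⟨fun h => ?_, fun ⟨u, hu, hD'⟩ => ?_⟩⟩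
  · obtain ⟨w, hw, hw'⟩ := hp.exists_unit_lift u
    refine ⟨_, isCentralDerivation_sub hp (g' := conjHom w g') (hpf hf') fun a => ?_,
      conjHom w g', fun a => by simp, Conjugate.symm ⟨w, fun a => rfl⟩⟩
    simp [conjHom_apply, hw, hw', hu]
  · obtain ⟨w, hw⟩ := h.symm
    have hu (a : A') : p w * f a = f a * p w := by
      have h₁ : f' a * w + D a * w = w * f' a := by
        rw [← add_mul, ← hg', hw, Units.inv_mul_cancel_right]
      have h₂ := congrArg p h₁
      simpa [hpf hf', hD.1] using h₂.symm
    exact ⟨Units.map (p : Λ' →* Λ) w, hu, (isDeltaF_iff hp (hpf hf') hu rfl rfl).2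
      fun a => (hg' a).symm.trans (hw a)⟩
  · obtain ⟨w, hw, hw'⟩ := hp.exists_unit_lift u
    exact Conjugate.symm
      ⟨w, fun a => (hg' a).trans ((isDeltaF_iff hp (hpf hf') hu hw hw').1 hD' a)⟩
end
end
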